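/- arXiv:1404.5892 — 3 statements merged into one kernel-verified Lean document; each statement's English description precedes it below -/
import Mathlib

section
/- Let Γ be a planar y-monotone poly-line drawing of a triangulated simple graph G in which all vertices and bends have integer y-coordinates. Then there exists a planar straight-line drawing Γ′ of G in which every vertex has the same y-coordinate as in Γ and which has the same left-to-right order in each row as Γ. -/
open Set

noncomputable section

/-- Points of the plane. -/
abbrev Pt : Type := ℝ × ℝ

/-- The image (set of points) of a polygonal chain given by its list of breakpoints. -/
def chainSet : List Pt → Set Pt
  | [] => ∅
  | [p] => {p}
  | p :: q :: rest => segment ℝ p q ∪ chainSet (q :: rest)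

/-- The bends (interior junction points) of a polygonal chain. -/
def chainBends (l : List Pt) : List Pt := (l.drop 1).dropLast

/-- `S` is the image of a simple (injective) curve from `a` to `b`. -/
def IsSimpleArc (S : Set Pt) (a b : Pt) : Prop :=
  ∃ γ : ℝ → Pt, ContinuousOn γ (Icc (0:ℝ) 1) ∧ InjOn γ (Icc (0:ℝ) 1) ∧
    γ '' Icc (0:ℝ) 1 = S ∧ γ 0 = a ∧ γ 1 = b

/-- A poly-line drawing of a simple graph `G`: an injective placement of the vertices
together with, for each edge, a simple polygonal arc joining the endpoints. -/
structure PolyDrawing {V : Type} (G : SimpleGraph V) where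
  pos : V → Pt
  pos_inj : Function.Injective pos
  arc : Sym2 V → List Pt
  arc_ends : ∀ u v : V, G.Adj u v →
    ((arc s(u, v)).head? = some (pos u) ∧ (arc s(u, v)).getLast? = some (pos v)) ∨
    ((arc s(u, v)).head? = some (pos v) ∧ (arc s(u, v)).getLast? = some (pos u))
  arc_simple : ∀ u v : V, G.Adj u v →
    IsSimpleArc (chainSet (arc s(u, v))) (pos u) (pos v)

namespace PolyDrawing

variable {V : Type} {G : SimpleGraph V}

/-- The set of points used by the arc of an edge. -/
def edgePts (Γ : PolyDrawing G) (e : Sym2 V) : Set Pt := chainSet (Γ.arc e)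

/-- Planarity: no vertex point lies on the arc of a non-incident edge, and arcs of
distinct edges meet only in images of common endpoints. -/
def IsPlanar (Γ : PolyDrawing G) : Prop :=
  (∀ v : V, ∀ e ∈ G.edgeSet, v ∉ e → Γ.pos v ∉ Γ.edgePts e) ∧
  (∀ e ∈ G.edgeSet, ∀ f ∈ G.edgeSet, e ≠ f →
    ∀ p ∈ Γ.edgePts e ∩ Γ.edgePts f, ∃ w : V, w ∈ e ∧ w ∈ f ∧ p = Γ.pos w)

/-- `y`-monotone: along every edge arc the `y`-coordinate varies weakly monotonically. -/
def IsYMonotone (Γ : PolyDrawing G) : Prop :=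
  ∀ e ∈ G.edgeSet,
    List.Chain' (· ≤ ·) ((Γ.arc e).map Prod.snd) ∨
    List.Chain' (· ≥ ·) ((Γ.arc e).map Prod.snd)

/-- The drawing has height `h`: every vertex and every bend has an integer
`y`-coordinate in `{1, …, h}`. -/
def HasHeight (Γ : PolyDrawing G) (h : ℕ) : Prop :=
  (∀ v : V, ∃ k : ℤ, 1 ≤ k ∧ k ≤ (h : ℤ) ∧ (Γ.pos v).2 = (k : ℝ)) ∧
  (∀ e ∈ G.edgeSet, ∀ p ∈ chainBends (Γ.arc e), ∃ k : ℤ, 1 ≤ k ∧ k ≤ (h : ℤ) ∧ p.2 = (k : ℝ))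

/-- All vertices and bends have integer `y`-coordinates. -/
def IntegerY (Γ : PolyDrawing G) : Prop :=
  (∀ v : V, ∃ k : ℤ, (Γ.pos v).2 = (k : ℝ)) ∧
  (∀ e ∈ G.edgeSet, ∀ p ∈ chainBends (Γ.arc e), ∃ k : ℤ, p.2 = (k : ℝ))

/-- The set of all points of the drawing (vertex points and edge arcs). -/
def image (Γ : PolyDrawing G) : Set Pt :=
  Set.range Γ.pos ∪ ⋃ e ∈ G.edgeSet, Γ.edgePts e

/-- The union of the unbounded connected components of the complement of the drawing. -/
def outerRegion (Γ : PolyDrawing G) : Set Pt :=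
  {p | p ∉ Γ.image ∧ ¬ Bornology.IsBounded (connectedComponentIn Γ.imageᶜ p)}

/-- A vertex is inner if its point does not lie on the boundary of the unbounded
connected component of the complement of the drawing. -/
def IsInner (Γ : PolyDrawing G) (v : V) : Prop :=
  Γ.pos v ∉ frontier Γ.outerRegion

/-- Number of incoming edges at `v` (edges whose other endpoint is weakly below `v`;
horizontal edges count as incoming). -/
def indeg (Γ : PolyDrawing G) (v : V) : ℕ :=
  {w : V | G.Adj v w ∧ (Γ.pos w).2 ≤ (Γ.pos v).2}.ncard

/-- Number of outgoing edges at `v` (edges whose other endpoint is weakly above `v`;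
horizontal edges count as outgoing). -/
def outdeg (Γ : PolyDrawing G) (v : V) : ℕ :=
  {w : V | G.Adj v w ∧ (Γ.pos v).2 ≤ (Γ.pos w).2}.ncard

/-- The set of points drawn for an element (vertex or edge) of the graph. -/
def drawSet (Γ : PolyDrawing G) : V ⊕ ↥G.edgeSet → Set Pt
  | Sum.inl v => {Γ.pos v}
  | Sum.inr e => Γ.edgePts e

end PolyDrawing

/-- A straight-line drawing of a simple graph: an injective placement of the vertices;
each edge is drawn as the closed segment between its endpoints. -/
structure StraightDrawing {V : Type} (G : SimpleGraph V) where
  pos : V → Pt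
  pos_inj : Function.Injective pos

namespace StraightDrawing

variable {V : Type} {G : SimpleGraph V}

/-- The closed segment representing an edge. -/
def edgePts (Γ : StraightDrawing G) (e : Sym2 V) : Set Pt :=
  Sym2.lift ⟨fun u v => segment ℝ (Γ.pos u) (Γ.pos v),
    fun u v => segment_symm (𝕜 := ℝ) (Γ.pos u) (Γ.pos v)⟩ e

/-- Planarity of a straight-line drawing. -/
def IsPlanar (Γ : StraightDrawing G) : Prop :=
  (∀ v : V, ∀ e ∈ G.edgeSet, v ∉ e → Γ.pos v ∉ Γ.edgePts e) ∧
  (∀ e ∈ G.edgeSet, ∀ f ∈ G.edgeSet, e ≠ f →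
    ∀ p ∈ Γ.edgePts e ∩ Γ.edgePts f, ∃ w : V, w ∈ e ∧ w ∈ f ∧ p = Γ.pos w)

/-- Every vertex has an integer `y`-coordinate in `{1, …, h}`. -/
def HeightLe (Γ : StraightDrawing G) (h : ℕ) : Prop :=
  ∀ v : V, ∃ k : ℤ, 1 ≤ k ∧ k ≤ (h : ℤ) ∧ (Γ.pos v).2 = (k : ℝ)

/-- All vertices lie on integer grid points. -/
def IsGrid (Γ : StraightDrawing G) : Prop :=
  ∀ v : V, ∃ p : ℤ × ℤ, Γ.pos v = ((p.1 : ℝ), (p.2 : ℝ))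

/-- The set of points drawn for an element (vertex or edge) of the graph. -/
def drawSet (Γ : StraightDrawing G) : V ⊕ ↥G.edgeSet → Set Pt
  | Sum.inl v => {Γ.pos v}
  | Sum.inr e => Γ.edgePts e

end StraightDrawing

/-- The intersection of a set of points with the horizontal line `y = r`,
recorded as a set of `x`-coordinates. -/
def rowSlice (S : Set Pt) (r : ℝ) : Set ℝ := {x : ℝ | (x, r) ∈ S}

/-- Two drawings (given by the sets drawn for each vertex/edge element) have the same
left-to-right order in each row: for every integer row `r` and elements `a`, `b` both
meeting row `r` in both drawings, the drawing of `a` lies entirely strictly to the left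
of that of `b` in one drawing iff it does in the other. -/
def SameRowOrder {α : Type} (D D' : α → Set Pt) : Prop :=
  ∀ r : ℤ, ∀ a b : α,
    (rowSlice (D a) (r : ℝ)).Nonempty → (rowSlice (D b) (r : ℝ)).Nonempty →
    (rowSlice (D' a) (r : ℝ)).Nonempty → (rowSlice (D' b) (r : ℝ)).Nonempty →
    ((∀ x ∈ rowSlice (D a) (r : ℝ), ∀ y ∈ rowSlice (D b) (r : ℝ), x < y) ↔
     (∀ x ∈ rowSlice (D' a) (r : ℝ), ∀ y ∈ rowSlice (D' b) (r : ℝ), x < y))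

/-- A simple graph on `n ≥ 3` vertices is triangulated (maximal planar) if it admits a
planar poly-line drawing and has exactly `3n - 6` edges. -/
def IsTriangulated {V : Type} [Fintype V] (G : SimpleGraph V) : Prop :=
  3 ≤ Fintype.card V ∧ G.edgeSet.ncard = 3 * Fintype.card V - 6 ∧
  ∃ Γ : PolyDrawing G, Γ.IsPlanar

/-- Data of a flat visibility representation: a horizontal segment for every vertex
(given by its `y`-coordinate and left/right `x`-coordinates) and a segment (given by
its two endpoints) for every edge. -/
structure VisData (V : Type) where
  ly : V → ℝ
  lx : V → ℝ
  rx : V → ℝ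
  ep1 : Sym2 V → Pt
  ep2 : Sym2 V → Pt

/-- The horizontal segment of a vertex. -/
def VisData.vseg {V : Type} (D : VisData V) (v : V) : Set Pt :=
  segment ℝ (D.lx v, D.ly v) (D.rx v, D.ly v)

/-- The segment of an edge. -/
def VisData.eseg {V : Type} (D : VisData V) (e : Sym2 V) : Set Pt :=
  segment ℝ (D.ep1 e) (D.ep2 e)

/-- `D` is a planar flat visibility representation of `G` of height `h`. -/
def IsFlatVisRep {V : Type} (G : SimpleGraph V) (D : VisData V) (h : ℕ) : Prop :=
  (∀ v : V, D.lx v ≤ D.rx v) ∧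
  (∀ v : V, ∃ k : ℤ, 1 ≤ k ∧ k ≤ (h : ℤ) ∧ D.ly v = (k : ℝ)) ∧
  (∀ e ∈ G.edgeSet, (D.ep1 e).1 = (D.ep2 e).1 ∨ (D.ep1 e).2 = (D.ep2 e).2) ∧
  (∀ e ∈ G.edgeSet, ∀ p ∈ D.eseg e, 1 ≤ p.2 ∧ p.2 ≤ (h : ℝ)) ∧
  (∀ u v : V, G.Adj u v →
    (D.ep1 s(u, v) ∈ D.vseg u ∧ D.ep2 s(u, v) ∈ D.vseg v) ∨
    (D.ep1 s(u, v) ∈ D.vseg v ∧ D.ep2 s(u, v) ∈ D.vseg u)) ∧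
  (∀ u v : V, u ≠ v → Disjoint (D.vseg u) (D.vseg v)) ∧
  (∀ e ∈ G.edgeSet, ∀ w : V, ∀ p ∈ D.eseg e ∩ D.vseg w, p = D.ep1 e ∨ p = D.ep2 e) ∧
  (∀ e ∈ G.edgeSet, ∀ f ∈ G.edgeSet, e ≠ f → ∀ p ∈ D.eseg e ∩ D.eseg f,
    (p = D.ep1 e ∨ p = D.ep2 e) ∧ (p = D.ep1 f ∨ p = D.ep2 f))

end

noncomputable section

/-- **Farkas' lemma** for a system of homogeneous linear equations and strict inequalities. -/
theorem exists_pos_or_exists_nonneg_combination {ι κ X : Type*} [Fintype ι] [Fintype κ]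
    [AddCommGroup X] [Module ℝ X] (a : ι → X →ₗ[ℝ] ℝ) (b : κ → X →ₗ[ℝ] ℝ) :
    (∃ y, (∀ k, b k y = 0) ∧ ∀ i, 0 < a i y) ∨
      ∃ (c : ι → ℝ) (m : κ → ℝ), (∀ i, 0 ≤ c i) ∧ c ≠ 0 ∧
        ∀ y, ∑ i, c i * a i y = ∑ k, m k * b k y := by
  classical
  rw [or_iff_not_imp_left]
  intro hno
  push Not at hno
  let K : Submodule ℝ X := ⨅ k, LinearMap.ker (b k)
  let A : Submodule ℝ (ι → ℝ) := K.map (LinearMap.pi a)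
  let P : Set (ι → ℝ) := Set.pi univ fun _ => Ioi 0
  have hP : IsOpen P := isOpen_set_pi finite_univ fun _ _ => isOpen_Ioi
  have hPc : Convex ℝ P := convex_pi fun _ _ => convex_Ioi 0
  have hdisj : Disjoint P (A : Set (ι → ℝ)) := by
    rw [Set.disjoint_left]
    rintro _ hz ⟨y, hy, rfl⟩
    obtain ⟨i, hi⟩ := hno y fun k => by
      have := (Submodule.mem_iInf _).mp hy k
      simpa using this
    exact absurd (hz i (mem_univ i)) (not_lt.mpr (by simpa using hi))
  obtain ⟨f, u, hfP, hfA⟩ := geometric_hahn_banach_open hPc hP A.convex hdisj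
  have hu : u ≤ 0 := by simpa using hfA 0 A.zero_mem
  have hA0 : ∀ z ∈ A, f z = 0 := by
    intro z hz
    by_contra hne
    have := hfA (((u - 1) / f z) • z) (A.smul_mem _ hz)
    rw [map_smul, smul_eq_mul, div_mul_cancel₀ _ hne] at this
    linarith
  have hrep : ∀ z, f z = ∑ i, z i * f (Pi.single i 1) := by
    intro z
    conv_lhs => rw [pi_eq_sum_univ' z]
    simp [map_sum]
  have hneg : ∀ i, f (Pi.single i 1) ≤ 0 := by
    intro i
    by_contra! hi
    have h1 : ∀ t : ℝ, 0 < t → ∑ j, f (Pi.single j 1) + t * f (Pi.single i 1) < 0 := by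
      intro t ht
      have := hfP (fun j => 1 + if j = i then t else 0) fun j _ => by
        simp only [mem_Ioi]; split_ifs <;> linarith
      rw [hrep] at this
      simp only [add_mul, one_mul, Finset.sum_add_distrib, ite_mul, zero_mul,
        Finset.sum_ite_eq', Finset.mem_univ, if_true] at this
      linarith
    have h2 := h1 ((|∑ j, f (Pi.single j 1)| + 1) / f (Pi.single i 1)) (by positivity)
    rw [div_mul_cancel₀ _ hi.ne'] at h2
    linarith [neg_abs_le (∑ j, f (Pi.single j 1))]
  have hspan : ∑ i, (-f (Pi.single i 1)) • a i ∈ Submodule.span ℝ (range b) := by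
    refine mem_span_of_iInf_ker_le_ker fun y hy => ?_
    have := hA0 (LinearMap.pi a y) ⟨y, hy, rfl⟩
    rw [hrep] at this
    simp only [LinearMap.mem_ker, LinearMap.coe_sum, Finset.sum_apply, LinearMap.smul_apply,
      smul_eq_mul, neg_mul, Finset.sum_neg_distrib, neg_eq_zero]
    rw [← this]
    exact Finset.sum_congr rfl fun i _ => by simp [mul_comm]
  obtain ⟨m, hm⟩ := (Submodule.mem_span_range_iff_exists_fun ℝ).mp hspan
  refine ⟨fun i => -f (Pi.single i 1), m, fun i => neg_nonneg.mpr (hneg i), fun h0 => ?_,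
    fun y => ?_⟩
  · have := hfP (fun _ => 1) fun _ _ => mem_Ioi.mpr one_pos
    rw [hrep] at this
    have h1 : ∀ i, f (Pi.single i 1) = 0 := fun i => neg_eq_zero.mp (congrFun h0 i)
    simp [h1] at this
    linarith
  · have := LinearMap.congr_fun hm y
    simpa using this.symm

/-- Combinatorial-metric data of a `y`-monotone drawing without horizontal edges: `p e r` is the
`x`-coordinate at which the edge `e` meets the row `r`. -/
structure LevelDrawing (V E : Type) where
  row : V → ℤ
  lo : E → V
  hi : E → V
  x : V → ℝ
  p : E → ℤ → ℝ
  row_lt : ∀ e, row (lo e) < row (hi e)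
  p_lo : ∀ e, p e (row (lo e)) = x (lo e)
  p_hi : ∀ e, p e (row (hi e)) = x (hi e)
  x_inj : ∀ v w, row v = row w → x v = x w → v = w
  p_ne_x : ∀ e v, row (lo e) < row v → row v < row (hi e) → p e (row v) ≠ x v
  p_inj : ∀ e f r, row (lo e) < r → r < row (hi e) → row (lo f) < r → r < row (hi f) →
    p e r = p f r → e = f
  simple : ∀ e f, lo e = lo f → hi e = hi f → e = f
  noncross : ∀ e f r, row (lo e) ≤ r → r + 1 ≤ row (hi e) → row (lo f) ≤ r → r + 1 ≤ row (hi f) →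
    p e r < p f r → p e (r + 1) ≤ p f (r + 1)

namespace LevelDrawing

variable {V E : Type}

/-- Reflection in a vertical line. -/
def flipX (C : LevelDrawing V E) : LevelDrawing V E where
  row := C.row
  lo := C.lo
  hi := C.hi
  x v := -C.x v
  p e r := -C.p e r
  row_lt := C.row_lt
  p_lo e := by rw [C.p_lo]
  p_hi e := by rw [C.p_hi]
  x_inj v w h h' := C.x_inj v w h (neg_injective h')
  p_ne_x e v h h' h'' := C.p_ne_x e v h h' (neg_injective h'')
  p_inj e f r h1 h2 h3 h4 h := C.p_inj e f r h1 h2 h3 h4 (neg_injective h)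
  simple := C.simple
  noncross e f r h1 h2 h3 h4 h :=
    neg_le_neg (C.noncross f e r h3 h4 h1 h2 (neg_lt_neg_iff.mp h))

/-- Reflection in a horizontal line. -/
def flipY (C : LevelDrawing V E) : LevelDrawing V E where
  row v := -C.row v
  lo := C.hi
  hi := C.lo
  x := C.x
  p e r := C.p e (-r)
  row_lt e := neg_lt_neg (C.row_lt e)
  p_lo e := by rw [neg_neg, C.p_hi]
  p_hi e := by rw [neg_neg, C.p_lo]
  x_inj v w h h' := C.x_inj v w (neg_injective h) h'
  p_ne_x e v h h' := by
    rw [neg_neg]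
    exact C.p_ne_x e v (neg_lt_neg_iff.mp h') (neg_lt_neg_iff.mp h)
  p_inj e f r h1 h2 h3 h4 h :=
    C.p_inj e f (-r) (by omega) (by omega) (by omega) (by omega) h
  simple e f h h' := C.simple e f h' h
  noncross e f r h1 h2 h3 h4 h := by
    by_contra! hc
    have := C.noncross f e (-(r + 1)) (by omega) (by omega) (by omega) (by omega) hc
    rw [show -(r + 1) + 1 = -r by ring] at this
    exact absurd h this.not_gt

/-- The edge `e` passes through row `r` away from its ends. -/
def Transit (C : LevelDrawing V E) (e : E) (r : ℤ) : Prop :=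
  C.row (C.lo e) < r ∧ r < C.row (C.hi e)

/-- The edge `e` meets row `r`. -/
def Meets (C : LevelDrawing V E) (e : E) (r : ℤ) : Prop :=
  C.row (C.lo e) ≤ r ∧ r ≤ C.row (C.hi e)

variable {C : LevelDrawing V E}

lemma Transit.meets {e : E} {r : ℤ} (h : C.Transit e r) : C.Meets e r := ⟨h.1.le, h.2.le⟩

lemma Meets.cases {e : E} {r : ℤ} (h : C.Meets e r) :
    C.row (C.lo e) = r ∨ C.row (C.hi e) = r ∨ C.Transit e r := by
  unfold Meets at h; unfold Transit; omega

lemma Transit.ne_x {e : E} {v : V} (h : C.Transit e (C.row v)) : C.p e (C.row v) ≠ C.x v :=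
  C.p_ne_x e v h.1 h.2

/-- A vertex on the drawing of an edge is one of its ends. -/
lemma eq_end_of_meets {e : E} {v : V} (h : C.Meets e (C.row v))
    (hp : C.p e (C.row v) = C.x v) : v = C.lo e ∨ v = C.hi e := by
  rcases h.cases with h' | h' | h'
  · exact Or.inl (C.x_inj _ _ h'.symm (by rw [← hp, ← h', C.p_lo]))
  · exact Or.inr (C.x_inj _ _ h'.symm (by rw [← hp, ← h', C.p_hi]))
  · exact absurd hp h'.ne_x

lemma Transit.eq_of_meets {e f : E} {r : ℤ} (he : C.Transit e r) (hf : C.Meets f r)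
    (h : C.p e r = C.p f r) : e = f := by
  rcases hf.cases with h' | h' | h'
  · subst h'; exact absurd (h.trans (C.p_lo f)) he.ne_x
  · subst h'; exact absurd (h.trans (C.p_hi f)) he.ne_x
  · exact C.p_inj e f r he.1 he.2 h'.1 h'.2 h

lemma le_of_lt_of_le {e f : E} {r s : ℤ} (hrs : r ≤ s) (he : C.Meets e r) (hf : C.Meets f r)
    (he' : C.Meets e s) (hf' : C.Meets f s) (h : C.p e r < C.p f r) : C.p e s ≤ C.p f s := by
  obtain ⟨n, rfl⟩ := Int.le.dest hrs
  induction n with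
  | zero => simpa using h.le
  | succ n ih =>
    have h1 : C.row (C.lo e) ≤ r := he.1
    have h2 : C.row (C.lo f) ≤ r := hf.1
    have h3 := he'.2
    have h4 := hf'.2
    push_cast at h3 h4
    have hle := ih (by omega) ⟨by omega, by omega⟩ ⟨by omega, by omega⟩
    have hlt : C.p e (r + n) < C.p f (r + n) := by
      rcases Nat.eq_zero_or_pos n with rfl | hn
      · simpa using h
      · refine lt_of_le_of_ne hle fun heq => ?_
        have : e = f := Transit.eq_of_meets (C := C) (r := r + n)
          ⟨by omega, by omega⟩ ⟨by omega, by omega⟩ heq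
        subst this
        exact lt_irrefl _ h
    have := C.noncross e f (r + n) (by omega) (by omega) (by omega) (by omega) hlt
    rw [show r + ((n + 1 : ℕ) : ℤ) = r + n + 1 by push_cast; ring]
    exact this

/-- The order of two edges does not reverse between two rows that both of them meet. -/
lemma le_of_lt_of_meets {e f : E} {r s : ℤ} (he : C.Meets e r) (hf : C.Meets f r)
    (he' : C.Meets e s) (hf' : C.Meets f s) (h : C.p e r < C.p f r) : C.p e s ≤ C.p f s := by
  rcases le_total r s with hrs | hrs
  · exact le_of_lt_of_le hrs he hf he' hf' h
  · by_contra! hc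
    exact absurd h (le_of_lt_of_le hrs hf' he' hf he hc).not_gt

lemma Transit.lt_of_lt {e f : E} {r s : ℤ} (hs : C.Transit e s) (he : C.Meets e r)
    (hf : C.Meets f r) (hf' : C.Meets f s) (h : C.p e r < C.p f r) : C.p e s < C.p f s :=
  lt_of_le_of_ne (le_of_lt_of_meets he hf hs.meets hf' h) fun heq =>
    h.ne (by rw [hs.eq_of_meets hf' heq])

lemma Transit.gt_of_gt {e f : E} {r s : ℤ} (hs : C.Transit e s) (he : C.Meets e r)
    (hf : C.Meets f r) (hf' : C.Meets f s) (h : C.p f r < C.p e r) : C.p f s < C.p e s :=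
  lt_of_le_of_ne (le_of_lt_of_meets hf he hf' hs.meets h) fun heq =>
    h.ne' (by rw [hs.eq_of_meets hf' heq.symm])

lemma transit_flipY {e : E} {r : ℤ} : C.flipY.Transit e (-r) ↔ C.Transit e r := by
  simp only [Transit, LevelDrawing.flipY, neg_lt_neg_iff]
  exact and_comm

variable [Fintype E]

/-- A bending-moment function on the edges which is concave across every family of rows. -/
structure Stress (C : LevelDrawing V E) where
  M : E → ℤ → ℝ
  M_zero : ∀ e r, ¬ C.Transit e r → M e r = 0
  conc : ∀ (r : ℤ) (φ : ℝ → ℝ), Antitone φ →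
    ∑ e, φ (C.p e r) * (M e (r + 1) - 2 * M e r + M e (r - 1)) ≤ 0

/-- Reflection of a stress in a vertical line. -/
def Stress.flipX (S : C.Stress) : C.flipX.Stress where
  M e r := -S.M e r
  M_zero e r h := by rw [S.M_zero e r h, neg_zero]
  conc r φ hφ := by
    have := S.conc r (fun t => -φ (-t)) (fun a b hab => neg_le_neg (hφ (neg_le_neg hab)))
    refine le_trans (le_of_eq (Finset.sum_congr rfl fun e _ => ?_)) this
    simp only [LevelDrawing.flipX]
    ring

/-- Reflection of a stress in a horizontal line. -/
def Stress.flipY (S : C.Stress) : C.flipY.Stress where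
  M e r := S.M e (-r)
  M_zero e r h := S.M_zero e (-r) fun h' => h ⟨neg_lt.mp h'.2, lt_neg.mp h'.1⟩
  conc r φ hφ := by
    refine le_trans (le_of_eq (Finset.sum_congr rfl fun e _ => ?_)) (S.conc (-r) φ hφ)
    simp only [LevelDrawing.flipY]
    rw [show -(r + 1) = -r - 1 by ring, show -(r - 1) = -r + 1 by ring]
    ring

namespace Stress

open Classical in
/-- The total moment in row `s` of the edges meeting row `r` inside `A`. -/
def cut (S : C.Stress) (r s : ℤ) (A : Set ℝ) : ℝ :=
  ∑ e, if C.p e r ∈ A then S.M e s else 0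

variable {S : C.Stress}

lemma transit_of_M_ne (S : C.Stress) {e : E} {r : ℤ} (h : S.M e r ≠ 0) : C.Transit e r := by
  by_contra h'
  exact h (S.M_zero e r h')

lemma cut_conc (S : C.Stress) (r : ℤ) {A : Set ℝ} (hA : IsLowerSet A) :
    S.cut r (r + 1) A + S.cut r (r - 1) A ≤ 2 * S.cut r r A := by
  classical
  have := S.conc r (fun t => if t ∈ A then 1 else 0) (fun a b hab => by
    by_cases hb : b ∈ A
    · simp [hb, hA hab hb]
    · simp only [hb, if_false]; split_ifs <;> norm_num)
  have h2 : S.cut r (r + 1) A + S.cut r (r - 1) A - 2 * S.cut r r A ≤ 0 := by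
    refine le_trans (le_of_eq ?_) this
    unfold cut
    rw [Finset.mul_sum, ← Finset.sum_add_distrib, ← Finset.sum_sub_distrib]
    refine Finset.sum_congr rfl fun e _ => ?_
    split_ifs <;> ring
  linarith

lemma cut_congr {r s r' : ℤ} {A B : Set ℝ}
    (h : ∀ e, C.Transit e s → (C.p e r ∈ A ↔ C.p e r' ∈ B)) : S.cut r s A = S.cut r' s B := by
  classical
  unfold cut
  refine Finset.sum_congr rfl fun e _ => ?_
  by_cases he : C.Transit e s
  · simp [h e he]
  · simp [S.M_zero e s he]

lemma cut_univ_congr {r s r' : ℤ} : S.cut r s univ = S.cut r' s univ :=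
  cut_congr fun _ _ => by simp

lemma exists_cut_up (S : C.Stress) (r : ℤ) {A : Set ℝ} (hA : IsLowerSet A) :
    ∃ B, IsLowerSet B ∧ S.cut r (r + 1) A = S.cut (r + 1) (r + 1) B := by
  refine ⟨{t | ∀ f, C.Meets f r → C.Meets f (r + 1) → C.p f r ∉ A → t < C.p f (r + 1)},
    fun a b hab ha f h1 h2 h3 => lt_of_le_of_lt hab (ha f h1 h2 h3), cut_congr fun e he => ?_⟩
  have hr : C.Meets e r := ⟨Int.lt_add_one_iff.mp he.1, by have := he.2; omega⟩
  constructor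
  · intro heA f hf hf' hfA
    have hlt : C.p e r < C.p f r := by
      by_contra! hc
      exact hfA (hA hc heA)
    exact he.lt_of_lt hr hf hf' hlt
  · intro h
    by_contra hc
    exact lt_irrefl _ (h e hr he.meets hc)

lemma cut_flipY (r s : ℤ) (A : Set ℝ) : S.flipY.cut (-r) (-s) A = S.cut r s A := by
  unfold cut
  refine Finset.sum_congr rfl fun e _ => ?_
  have h1 : C.flipY.p e (-r) = C.p e r := by simp [LevelDrawing.flipY]
  have h2 : S.flipY.M e (-s) = S.M e s := by simp [flipY]
  by_cases h : C.p e r ∈ A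
  · rw [if_pos h, if_pos (h1 ▸ h), h2]
  · rw [if_neg h, if_neg (h1 ▸ h)]

lemma exists_cut_down (S : C.Stress) (r : ℤ) {A : Set ℝ} (hA : IsLowerSet A) :
    ∃ B, IsLowerSet B ∧ S.cut r (r - 1) A = S.cut (r - 1) (r - 1) B := by
  obtain ⟨B, hB, h⟩ := S.flipY.exists_cut_up (-r) hA
  refine ⟨B, hB, ?_⟩
  rw [show -r + 1 = -(r - 1) by ring, cut_flipY, cut_flipY] at h
  exact h

lemma exists_bound (S : C.Stress) : ∃ N : ℤ, ∀ e r, S.M e r ≠ 0 → -N ≤ r ∧ r ≤ N := by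
  refine ⟨∑ e, (|C.row (C.lo e)| + |C.row (C.hi e)|), fun e r h => ?_⟩
  have h1 := (S.transit_of_M_ne h).1
  have h2 := (S.transit_of_M_ne h).2
  have h3 : |C.row (C.lo e)| + |C.row (C.hi e)| ≤ ∑ e, (|C.row (C.lo e)| + |C.row (C.hi e)|) :=
    Finset.single_le_sum (f := fun e => |C.row (C.lo e)| + |C.row (C.hi e)|)
      (fun e _ => by positivity) (Finset.mem_univ e)
  have h4 := neg_abs_le (C.row (C.lo e))
  have h5 := le_abs_self (C.row (C.hi e))
  have h6 := abs_nonneg (C.row (C.lo e))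
  have h7 := abs_nonneg (C.row (C.hi e))
  omega

lemma cut_nonneg (S : C.Stress) (r : ℤ) {A : Set ℝ} (hA : IsLowerSet A) : 0 ≤ S.cut r r A := by
  classical
  obtain ⟨N, hN⟩ := S.exists_bound
  have hzero : ∀ s, N < s → ∀ A, S.cut s s A = 0 := fun s hs A =>
    Finset.sum_eq_zero fun e _ => by
      have : S.M e s = 0 := by
        by_contra h
        have := (hN e s h).2
        omega
      simp [this]
  have hfin : {q : ℝ | ∃ s A, IsLowerSet A ∧ q = S.cut s s A}.Finite := by
    refine (Set.Finite.union (Set.toFinite ((fun a : Finset E × ↥(Finset.Icc (-N) N) =>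
      ∑ e ∈ a.1, S.M e a.2) '' univ)) (Set.finite_singleton (0 : ℝ))).subset ?_
    rintro q ⟨s, A, -, rfl⟩
    by_cases hs : s ∈ Finset.Icc (-N) N
    · refine Or.inl ⟨(Finset.univ.filter fun e => C.p e s ∈ A, ⟨s, hs⟩), trivial, ?_⟩
      simp only [cut]
      rw [Finset.sum_filter]
    · refine Or.inr (Finset.sum_eq_zero fun e _ => ?_)
      have : S.M e s = 0 := by
        by_contra h
        exact hs (Finset.mem_Icc.mpr (hN e s h))
      simp [this]
  obtain ⟨m, ⟨s, B, hB, hm⟩, hmin⟩ :=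
    Set.exists_min_image _ id hfin ⟨_, r, A, hA, rfl⟩
  have key : ∀ n : ℕ, ∃ B, IsLowerSet B ∧ S.cut (s + n) (s + n) B = m := by
    intro n
    induction n with
    | zero => exact ⟨B, hB, by simp [hm]⟩
    | succ n ih =>
      obtain ⟨B, hB, h⟩ := ih
      obtain ⟨B1, hB1, h1⟩ := S.exists_cut_up (s + n) hB
      obtain ⟨B2, hB2, h2⟩ := S.exists_cut_down (s + n) hB
      have h3 := S.cut_conc (s + n) hB
      have h4 := hmin (S.cut (s + n + 1) (s + n + 1) B1) ⟨_, B1, hB1, rfl⟩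
      have h5 := hmin (S.cut (s + n - 1) (s + n - 1) B2) ⟨_, B2, hB2, rfl⟩
      simp only [id] at h4 h5
      refine ⟨B1, hB1, ?_⟩
      push_cast
      rw [← add_assoc]
      linarith
  obtain ⟨B', -, h⟩ := key (N - s + 1).toNat
  rw [hzero _ (by omega)] at h
  have := hmin _ ⟨r, A, hA, rfl⟩
  simp only [id] at this
  linarith

lemma cut_up_eq_zero {r : ℤ} {A : Set ℝ} (hA : IsLowerSet A) (h : S.cut r r A = 0) :
    S.cut r (r + 1) A = 0 := by
  obtain ⟨B1, hB1, h1⟩ := S.exists_cut_up r hA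
  obtain ⟨B2, hB2, h2⟩ := S.exists_cut_down r hA
  have h3 := S.cut_conc r hA
  have h4 := S.cut_nonneg (r + 1) hB1
  have h5 := S.cut_nonneg (r - 1) hB2
  linarith

lemma cut_down_eq_zero {r : ℤ} {A : Set ℝ} (hA : IsLowerSet A) (h : S.cut r r A = 0) :
    S.cut r (r - 1) A = 0 := by
  obtain ⟨B1, hB1, h1⟩ := S.exists_cut_up r hA
  obtain ⟨B2, hB2, h2⟩ := S.exists_cut_down r hA
  have h3 := S.cut_conc r hA
  have h4 := S.cut_nonneg (r + 1) hB1
  have h5 := S.cut_nonneg (r - 1) hB2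
  linarith

lemma cut_univ (S : C.Stress) (r : ℤ) : S.cut r r univ = 0 := by
  classical
  obtain ⟨N, hN⟩ := S.exists_bound
  have key : ∀ n : ℕ, S.cut (-N - 1 + n) (-N - 1 + n) univ = 0 := by
    intro n
    induction n with
    | zero =>
      refine Finset.sum_eq_zero fun e _ => ?_
      have : S.M e (-N - 1 + (0 : ℕ)) = 0 := by
        by_contra h
        have := (hN e _ h).1
        omega
      simp only [this, ite_self]
    | succ n ih =>
      have := cut_up_eq_zero isLowerSet_univ ih
      rw [cut_univ_congr (r' := -N - 1 + n + 1)] at this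
      push_cast
      rw [← add_assoc]
      exact this
  by_cases h : -N - 1 ≤ r
  · have := key (r + N + 1).toNat
    rwa [show -N - 1 + ((r + N + 1).toNat : ℤ) = r by omega] at this
  · refine Finset.sum_eq_zero fun e _ => ?_
    have : S.M e r = 0 := by
      by_contra h'
      have := (hN e _ h').1
      omega
    simp only [this, ite_self]

lemma cut_Iic {e : E} {r : ℤ} (he : C.Transit e r) :
    S.cut r r (Iic (C.p e r)) = S.cut r r (Iio (C.p e r)) + S.M e r := by
  classical
  have : S.M e r = ∑ f, if f = e then S.M f r else 0 := by simp
  rw [this]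
  unfold cut
  rw [← Finset.sum_add_distrib]
  refine Finset.sum_congr rfl fun f _ => ?_
  by_cases hfe : f = e
  · subst hfe; simp
  · by_cases hf : C.Transit f r
    · have : C.p f r ≠ C.p e r := fun h => hfe (hf.eq_of_meets he.meets h)
      simp only [mem_Iic, mem_Iio, hfe, if_false, add_zero, le_iff_lt_or_eq, this, or_false]
    · simp [S.M_zero f r hf, hfe]

/-- `e` bounds a region of positive moment from the left at row `r`. -/
def BoundsLeft (S : C.Stress) (e : E) (r : ℤ) : Prop :=
  S.cut r r (Iio (C.p e r)) = 0 ∧ 0 < S.M e r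

/-- `e` bounds a region of positive moment from the right at row `r`. -/
def BoundsRight (S : C.Stress) (e : E) (r : ℤ) : Prop :=
  S.cut r r (Iic (C.p e r)) = 0 ∧ S.M e r < 0

lemma flipX_cut_Iio (e : E) (r : ℤ) :
    S.flipX.cut r r (Iio (C.flipX.p e r)) = S.cut r r (Iic (C.p e r)) := by
  classical
  have h : S.flipX.cut r r (Iio (C.flipX.p e r)) + S.cut r r univ = S.cut r r (Iic (C.p e r)) := by
    unfold cut
    rw [← Finset.sum_add_distrib]
    refine Finset.sum_congr rfl fun f _ => ?_
    simp only [LevelDrawing.flipX, flipX, mem_Iio, mem_Iic, neg_lt_neg_iff, mem_univ, if_true]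
    by_cases h : C.p e r < C.p f r
    · simp [h, not_le.mpr h]
    · simp [h, not_lt.mp h]
  rw [← h, S.cut_univ, add_zero]

lemma boundsLeft_flipX {e : E} {r : ℤ} : S.flipX.BoundsLeft e r ↔ S.BoundsRight e r := by
  unfold BoundsLeft BoundsRight
  rw [flipX_cut_Iio]
  simp [flipX]

lemma boundsRight_flipX {e : E} {r : ℤ} : S.flipX.BoundsRight e r ↔ S.BoundsLeft e r := by
  have key : ∀ h : C.Transit e r,
      S.flipX.cut r r (Iic (C.flipX.p e r)) = S.cut r r (Iio (C.p e r)) := fun h => by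
    rw [cut_Iic (C := C.flipX) (S := S.flipX) h, flipX_cut_Iio, cut_Iic h]
    simp [flipX]
  have hM : S.flipX.M e r < 0 ↔ 0 < S.M e r := by simp [flipX]
  constructor
  · rintro ⟨h1, h2⟩
    rw [hM] at h2
    exact ⟨(key (S.transit_of_M_ne h2.ne')).symm.trans h1, h2⟩
  · rintro ⟨h1, h2⟩
    exact ⟨(key (S.transit_of_M_ne h2.ne')).trans h1, hM.mpr h2⟩

lemma BoundsLeft.transit {e : E} {r : ℤ} (h : S.BoundsLeft e r) : C.Transit e r :=
  S.transit_of_M_ne h.2.ne'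

lemma BoundsRight.transit {e : E} {r : ℤ} (h : S.BoundsRight e r) : C.Transit e r :=
  S.transit_of_M_ne h.2.ne

lemma BoundsLeft.succ {e : E} {r : ℤ} (h : S.BoundsLeft e r) (he : C.Transit e (r + 1)) :
    S.BoundsLeft e (r + 1) := by
  have htr := h.transit
  have h1 : S.cut (r + 1) (r + 1) (Iio (C.p e (r + 1))) = 0 := by
    rw [← cut_up_eq_zero (isLowerSet_Iio _) h.1]
    refine cut_congr fun f hf => ?_
    have hf' : C.Meets f r := ⟨Int.lt_add_one_iff.mp hf.1, by have := hf.2; omega⟩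
    exact ⟨fun h => htr.gt_of_gt he.meets hf.meets hf' h,
      fun h => he.gt_of_gt htr.meets hf' hf.meets h⟩
  refine ⟨h1, lt_of_le_of_ne ?_ fun h0 => ?_⟩
  · have := S.cut_nonneg (r + 1) (isLowerSet_Iic (C.p e (r + 1)))
    rwa [cut_Iic he, h1, zero_add] at this
  · have h2 : S.cut (r + 1) (r + 1) (Iic (C.p e (r + 1))) = 0 := by
      rw [cut_Iic he, h1, ← h0, add_zero]
    have h3 := cut_down_eq_zero (isLowerSet_Iic _) h2
    have h4 : S.cut (r + 1) (r + 1 - 1) (Iic (C.p e (r + 1))) = S.cut r r (Iic (C.p e r)) := by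
      rw [add_sub_cancel_right]
      refine cut_congr fun f hf => ?_
      have hf' : C.Meets f (r + 1) := ⟨by have := hf.1; omega, Int.add_one_le_iff.mpr hf.2⟩
      rw [mem_Iic, mem_Iic, ← not_lt, ← not_lt, not_iff_not]
      exact ⟨fun h => htr.lt_of_lt he.meets hf' hf.meets h,
        fun h => he.lt_of_lt htr.meets hf.meets hf' h⟩
    rw [h4, cut_Iic htr, h.1, zero_add] at h3
    exact h.2.ne' h3

lemma cut_Iio_flipY (e : E) (r : ℤ) :
    S.flipY.cut (-r) (-r) (Iio (C.flipY.p e (-r))) = S.cut r r (Iio (C.p e r)) := by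
  rw [cut_flipY]
  simp only [LevelDrawing.flipY, neg_neg]

lemma boundsLeft_flipY {e : E} {r : ℤ} : S.flipY.BoundsLeft e (-r) ↔ S.BoundsLeft e r := by
  unfold BoundsLeft
  rw [cut_Iio_flipY]
  simp only [flipY, neg_neg]

lemma boundsRight_flipY {e : E} {r : ℤ} : S.flipY.BoundsRight e (-r) ↔ S.BoundsRight e r := by
  unfold BoundsRight
  rw [cut_flipY]
  simp only [flipY, LevelDrawing.flipY, neg_neg]

lemma BoundsLeft.of_le {e : E} {r s : ℤ} (h : S.BoundsLeft e r) (hs : C.Transit e s)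
    (hrs : r ≤ s) : S.BoundsLeft e s := by
  obtain ⟨n, rfl⟩ := Int.le.dest hrs
  clear hrs
  induction n with
  | zero => simpa using h
  | succ n ih =>
    have h1 := h.transit.1
    have h2 := hs.2
    push_cast at h2
    have := (ih ⟨by omega, by omega⟩).succ ⟨by omega, by omega⟩
    push_cast
    rwa [← add_assoc]

lemma BoundsLeft.of_transit {e : E} {r s : ℤ} (h : S.BoundsLeft e r) (hs : C.Transit e s) :
    S.BoundsLeft e s := by
  rcases le_total r s with hrs | hrs
  · exact h.of_le hs hrs
  · exact boundsLeft_flipY.mp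
      ((boundsLeft_flipY.mpr h).of_le (transit_flipY.mpr hs) (neg_le_neg hrs))

lemma BoundsLeft.exists_top {e : E} {r : ℤ} (h : S.BoundsLeft e r)
    (hr : r + 1 = C.row (C.hi e)) :
    ∃ g, S.BoundsRight g r ∧ C.hi g = C.hi e ∧ C.p e r < C.p g r := by
  classical
  have htr := h.transit
  have hme : C.Meets e (r + 1) := ⟨by have := htr.1; omega, hr.le⟩
  have hpe : C.p e (r + 1) = C.x (C.hi e) := by rw [hr, C.p_hi]
  have hz : ∀ f, C.Meets f (r + 1) → C.p f (r + 1) = C.p e (r + 1) → ¬ C.Transit f (r + 1) :=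
    fun f _ hp hf => by
      rw [hpe, hr] at hp
      rw [hr] at hf
      exact hf.ne_x hp
  have h1 : S.cut (r + 1) (r + 1) (Iic (C.p e (r + 1))) = 0 := by
    rw [← cut_up_eq_zero (isLowerSet_Iio _) h.1]
    refine cut_congr fun f hf => ?_
    have hf' : C.Meets f r := ⟨Int.lt_add_one_iff.mp hf.1, by have := hf.2; omega⟩
    rw [mem_Iic, mem_Iio]
    constructor
    · intro hle
      exact htr.gt_of_gt hme hf.meets hf' (lt_of_le_of_ne hle fun heq => hz f hf.meets heq hf)
    · intro hlt
      exact le_of_lt_of_meets hf' htr.meets hf.meets hme hlt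
  have h2 := cut_down_eq_zero (isLowerSet_Iic _) h1
  rw [add_sub_cancel_right] at h2
  have hup : ∀ f, C.Transit f r → C.Meets f (r + 1) := fun f hf =>
    ⟨by have := hf.1; omega, Int.add_one_le_iff.mpr hf.2⟩
  let K : Finset E := Finset.univ.filter fun f =>
    S.M f r ≠ 0 ∧ C.p e r < C.p f r ∧ C.p f (r + 1) ≤ C.p e (r + 1)
  have hK : K.Nonempty := by
    by_contra hK
    rw [Finset.not_nonempty_iff_eq_empty] at hK
    have h3 : S.cut (r + 1) r (Iic (C.p e (r + 1))) = S.cut r r (Iic (C.p e r)) := by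
      unfold cut
      refine Finset.sum_congr rfl fun f _ => ?_
      by_cases hM : S.M f r = 0
      · simp [hM]
      have hf := S.transit_of_M_ne hM
      refine if_congr ?_ rfl rfl
      rw [mem_Iic, mem_Iic]
      constructor
      · intro hle
        by_contra! hlt
        have : f ∈ K := by simp [K, hM, hlt, hle]
        simp [hK] at this
      · intro hle
        rcases hle.lt_or_eq with hlt | heq
        · exact le_of_lt_of_meets hf.meets htr.meets (hup f hf) hme hlt
        · rw [hf.eq_of_meets htr.meets heq]
    rw [h3, cut_Iic htr, h.1, zero_add] at h2
    exact h.2.ne' h2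
  obtain ⟨g, hg, hmax⟩ := K.exists_max_image (fun f => C.p f r) hK
  simp only [K, Finset.mem_filter, Finset.mem_univ, true_and] at hg hmax
  obtain ⟨hM, hlt, hle⟩ := hg
  have hgt := S.transit_of_M_ne hM
  have heq : C.p g (r + 1) = C.p e (r + 1) :=
    le_antisymm hle (le_of_lt_of_meets htr.meets hgt.meets hme (hup g hgt) hlt)
  have hhi : C.hi g = C.hi e := by
    rcases (hup g hgt).cases with h' | h' | h'
    · have := hgt.1; omega
    · refine C.x_inj _ _ (by omega) ?_
      rw [← hpe, ← heq, ← h', C.p_hi]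
    · exact absurd h' (hz g (hup g hgt) heq)
  have h4 : S.cut r r (Iic (C.p g r)) = 0 := by
    rw [← h2]
    unfold cut
    refine Finset.sum_congr rfl fun f _ => ?_
    by_cases hM : S.M f r = 0
    · simp [hM]
    have hf := S.transit_of_M_ne hM
    refine if_congr ?_ rfl rfl
    rw [mem_Iic, mem_Iic]
    constructor
    · intro hle'
      rw [← heq]
      rcases hle'.lt_or_eq with hlt' | heq'
      · exact le_of_lt_of_meets hf.meets hgt.meets (hup f hf) (hup g hgt) hlt'
      · rw [hf.eq_of_meets hgt.meets heq']
    · intro hle'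
      by_contra! hc
      exact absurd (hmax f ⟨hM, hlt.trans hc, hle'⟩) hc.not_ge
  refine ⟨g, ⟨h4, lt_of_le_of_ne ?_ hM⟩, hhi, hlt⟩
  have h5 := S.cut_nonneg r (isLowerSet_Iio (C.p g r))
  rw [cut_Iic hgt] at h4
  linarith

lemma BoundsLeft.exists_bot {e : E} {r : ℤ} (h : S.BoundsLeft e r)
    (hr : r - 1 = C.row (C.lo e)) :
    ∃ g, S.BoundsRight g r ∧ C.lo g = C.lo e ∧ C.p e r < C.p g r := by
  obtain ⟨g, h1, h2, h3⟩ := (boundsLeft_flipY.mpr h).exists_top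
    (by simp only [LevelDrawing.flipY]; omega)
  refine ⟨g, boundsRight_flipY.mp h1, h2, ?_⟩
  simpa only [LevelDrawing.flipY, neg_neg] using h3

/-- A left boundary edge of minimal height leads to a pair of parallel edges. -/
lemma BoundsLeft.elim_of_minimal {e : E} {r : ℤ} (h : S.BoundsLeft e r)
    (hmin : ∀ g s, S.BoundsRight g s →
      C.row (C.hi e) - C.row (C.lo e) ≤ C.row (C.hi g) - C.row (C.lo g)) : False := by
  have h1 := h.transit.1
  have h2 := h.transit.2
  have ht : C.Transit e (C.row (C.hi e) - 1) := ⟨by omega, by omega⟩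
  have hb : C.Transit e (C.row (C.lo e) + 1) := ⟨by omega, by omega⟩
  obtain ⟨g, hgR, hg, hlt⟩ := (h.of_transit ht).exists_top (by ring)
  obtain ⟨k, hkR, hk, hlt'⟩ := (h.of_transit hb).exists_bot (by ring)
  have hgs := hmin g _ hgR
  have hks := hmin k _ hkR
  rw [hg] at hgs
  rw [hk] at hks
  have hne : e ≠ g := by rintro rfl; exact lt_irrefl _ hlt
  have hne' : e ≠ k := by rintro rfl; exact lt_irrefl _ hlt'
  have heb : C.Meets e (C.row (C.lo e)) := ⟨le_rfl, by omega⟩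
  have het : C.Meets e (C.row (C.hi e)) := ⟨by omega, le_rfl⟩
  have hgb : C.Meets g (C.row (C.lo e)) := ⟨by omega, by rw [hg]; omega⟩
  have hgt : C.Meets g (C.row (C.hi e)) := ⟨by omega, by rw [hg]⟩
  have hkb : C.Meets k (C.row (C.lo e)) := ⟨by rw [hk], by omega⟩
  have hkt : C.Meets k (C.row (C.hi e)) := ⟨by rw [hk]; omega, by omega⟩
  have hlo : C.x (C.lo e) ≠ C.p g (C.row (C.lo e)) := fun heq => by
    rcases eq_end_of_meets hgb heq.symm with h' | h'
    · exact hne (C.simple _ _ h' hg.symm)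
    · rw [h', hg] at h1
      omega
  have h3 : C.p e (C.row (C.lo e)) < C.p g (C.row (C.lo e)) :=
    lt_of_le_of_ne (le_of_lt_of_meets ht.meets hgR.transit.meets heb hgb hlt) (by rwa [C.p_lo])
  have h4 : C.p k (C.row (C.lo e)) < C.p g (C.row (C.lo e)) := by
    have : C.p k (C.row (C.lo e)) = C.p e (C.row (C.lo e)) := by
      rw [C.p_lo, ← hk, C.p_lo]
    rwa [this]
  have h5 := le_of_lt_of_meets hkb hgb hkt hgt h4
  have h6 := le_of_lt_of_meets hb.meets hkR.transit.meets het hkt hlt'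
  rw [← hg, C.p_hi, hg] at h5
  rw [C.p_hi] at h6
  rcases eq_end_of_meets hkt (le_antisymm h5 h6) with h' | h'
  · rw [h', hk] at h2
    omega
  · exact hne' (C.simple _ _ hk.symm h')

lemma exists_boundsLeft {e : E} {r : ℤ} (h : S.M e r ≠ 0) : ∃ f, S.BoundsLeft f r := by
  classical
  obtain ⟨f, hf, hmin⟩ := (Finset.univ.filter fun f => S.M f r ≠ 0).exists_min_image
    (fun f => C.p f r) ⟨e, by simp [h]⟩
  simp only [Finset.mem_filter, Finset.mem_univ, true_and] at hf hmin
  have h1 : S.cut r r (Iio (C.p f r)) = 0 := by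
    refine Finset.sum_eq_zero fun g _ => ?_
    by_cases hg : S.M g r = 0
    · simp [hg]
    · simp [(hmin g hg)]
  refine ⟨f, h1, lt_of_le_of_ne ?_ hf.symm⟩
  have := S.cut_nonneg r (isLowerSet_Iic (C.p f r))
  rwa [cut_Iic (S.transit_of_M_ne hf), h1, zero_add] at this

/-- A drawing without parallel edges carries no nonzero stress. -/
theorem M_eq_zero (S : C.Stress) (e : E) (r : ℤ) : S.M e r = 0 := by
  classical
  by_contra h
  obtain ⟨f, hf⟩ := exists_boundsLeft h
  obtain ⟨g, hg, hmin⟩ := (Finset.univ.filter fun g =>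
    ∃ s, S.BoundsLeft g s ∨ S.BoundsRight g s).exists_min_image
    (fun g => C.row (C.hi g) - C.row (C.lo g)) ⟨f, by simpa using ⟨r, Or.inl hf⟩⟩
  simp only [Finset.mem_filter, Finset.mem_univ, true_and] at hg hmin
  obtain ⟨s, hs | hs⟩ := hg
  · exact hs.elim_of_minimal fun k t hk => hmin k ⟨t, Or.inr hk⟩
  · exact (boundsLeft_flipX.mpr hs).elim_of_minimal fun k t hk =>
      hmin k ⟨t, Or.inl (boundsRight_flipX.mp hk)⟩

end Stress
end LevelDrawing

/-- A sequence with vanishing second differences on an interval is affine there. -/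
lemma eq_affine_of_second_difference {g : ℤ → ℝ} {l h : ℤ}
    (hg : ∀ r, l < r → r < h → g (r + 1) - 2 * g r + g (r - 1) = 0) {r : ℤ} (h1 : l ≤ r)
    (h2 : r ≤ h) (hlh : l < h) : g r = g l + (r - l) / (h - l) * (g h - g l) := by
  have key : ∀ k : ℕ, l + k + 1 ≤ h → g (l + k) = g l + k * (g (l + 1) - g l) ∧
      g (l + k + 1) = g l + (k + 1) * (g (l + 1) - g l) := by
    intro k
    induction k with
    | zero => intro _; constructor <;> simp
    | succ k ih =>
      intro hk
      push_cast at hk ⊢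
      obtain ⟨i1, i2⟩ := ih (by omega)
      have h3 := hg (l + k + 1) (by omega) (by omega)
      rw [show l + (k : ℤ) + 1 - 1 = l + k by ring, i1] at h3
      rw [← add_assoc]
      refine ⟨i2, ?_⟩
      rw [i2] at h3
      linarith
  have key' : ∀ s, l ≤ s → s ≤ h → g s = g l + (s - l) * (g (l + 1) - g l) := by
    intro s hs hs'
    obtain ⟨k, rfl⟩ := Int.le.dest hs
    rcases hs'.lt_or_eq with hlt | rfl
    · rw [(key k (by omega)).1]
      push_cast
      ring
    · obtain ⟨j, rfl⟩ : ∃ j, k = j + 1 := ⟨k - 1, by omega⟩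
      have := (key j (by push_cast; omega)).2
      push_cast at this ⊢
      rw [← add_assoc, this]
      ring
  have hne : ((h : ℝ) - l) ≠ 0 := sub_ne_zero.mpr (by exact_mod_cast hlh.ne')
  rw [key' r h1 h2, key' h hlh.le le_rfl]
  field_simp
  ring

namespace LevelDrawing

variable {V E : Type}

/-- The vertex or edge `n` has a node on row `r`. -/
def Alive (C : LevelDrawing V E) : V ⊕ E → ℤ → Prop
  | Sum.inl v, r => C.row v = r
  | Sum.inr e, r => C.Transit e r

/-- The coordinate of the node of `n` on row `r`, as a linear function of a choice of coordinates
for all vertices and all crossings of edges with rows. -/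
def node : V ⊕ E → ℤ → ((V → ℝ) × (E → ℤ → ℝ)) →ₗ[ℝ] ℝ
  | Sum.inl v, _ => LinearMap.proj v ∘ₗ LinearMap.fst ℝ _ _
  | Sum.inr e, r => LinearMap.proj r ∘ₗ LinearMap.proj e ∘ₗ LinearMap.snd ℝ _ _

@[simp] lemma node_inl (v : V) (r : ℤ) (y : (V → ℝ) × (E → ℤ → ℝ)) :
    node (Sum.inl v) r y = y.1 v := rfl

@[simp] lemma node_inr (e : E) (r : ℤ) (y : (V → ℝ) × (E → ℤ → ℝ)) :
    node (Sum.inr e) r y = y.2 e r := rfl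

/-- Second difference of the crossings of `e`, at row `r`. -/
def bend (e : E) (r : ℤ) : ((V → ℝ) × (E → ℤ → ℝ)) →ₗ[ℝ] ℝ :=
  node (Sum.inr e) (r + 1) - (2 : ℝ) • node (Sum.inr e) r + node (Sum.inr e) (r - 1)

@[simp] lemma bend_apply (e : E) (r : ℤ) (y : (V → ℝ) × (E → ℤ → ℝ)) :
    bend e r y = y.2 e (r + 1) - 2 * y.2 e r + y.2 e (r - 1) := rfl

/-- The crossing of height `t` with the straight segment replacing `e`, when the vertices are
placed at the horizontal coordinates `Y`. -/
def line (C : LevelDrawing V E) (Y : V → ℝ) (e : E) (t : ℝ) : ℝ :=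
  Y (C.lo e) + (t - C.row (C.lo e)) / (C.row (C.hi e) - C.row (C.lo e)) *
    (Y (C.hi e) - Y (C.lo e))

/-- The coordinates of all vertices and crossings of a drawing. -/
def coords (C : LevelDrawing V E) : (V → ℝ) × (E → ℤ → ℝ) := (C.x, C.p)

/-- The coordinates of all vertices and crossings after straightening the edges. -/
def straight (C : LevelDrawing V E) (Y : V → ℝ) : (V → ℝ) × (E → ℤ → ℝ) :=
  (Y, fun e r => C.line Y e r)

variable (C : LevelDrawing V E)

section Straightening

variable [Fintype V]

lemma Alive.bound {n : V ⊕ E} {r : ℤ} (h : C.Alive n r) :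
    r ∈ Finset.Icc (-∑ v, |C.row v|) (∑ v, |C.row v|) := by
  have h3 : ∀ v, |C.row v| ≤ ∑ v, |C.row v| := fun v =>
    Finset.single_le_sum (fun v _ => abs_nonneg (C.row v)) (Finset.mem_univ v)
  rw [Finset.mem_Icc]
  rcases n with v | e
  · obtain rfl : C.row v = r := h
    exact abs_le.mp (h3 v)
  · have h4 := abs_le.mp (h3 (C.lo e))
    have h5 := abs_le.mp (h3 (C.hi e))
    obtain ⟨h1, h2⟩ : C.Transit e r := h
    omega

variable [Fintype E]

lemma finite_pairs : {q : (V ⊕ E) × (V ⊕ E) × ℤ | C.Alive q.1 q.2.2 ∧ C.Alive q.2.1 q.2.2 ∧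
    node q.1 q.2.2 C.coords < node q.2.1 q.2.2 C.coords}.Finite :=
  (finite_univ.prod (finite_univ.prod (Finset.finite_toSet _))).subset
    fun _ hq => ⟨mem_univ _, mem_univ _, hq.1.bound⟩

/-- Every drawing can be straightened out without changing the order of the nodes on any row. -/
theorem exists_straightening : ∃ Y : V → ℝ, ∀ r a b, C.Alive a r → C.Alive b r →
    node a r C.coords < node b r C.coords →
    node a r (C.straight Y) < node b r (C.straight Y) := by
  classical
  let I := {q : (V ⊕ E) × (V ⊕ E) × ℤ // C.Alive q.1 q.2.2 ∧ C.Alive q.2.1 q.2.2 ∧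
    node q.1 q.2.2 C.coords < node q.2.1 q.2.2 C.coords}
  have : Fintype I := C.finite_pairs.fintype
  let T (e : E) : Finset ℤ := Finset.Ioo (C.row (C.lo e)) (C.row (C.hi e))
  let a : I → ((V → ℝ) × (E → ℤ → ℝ)) →ₗ[ℝ] ℝ := fun i =>
    node i.1.2.1 i.1.2.2 - node i.1.1 i.1.2.2
  let b : (Σ e, T e) ⊕ E ⊕ E → ((V → ℝ) × (E → ℤ → ℝ)) →ₗ[ℝ] ℝ :=
    Sum.elim (fun q => bend q.1 q.2) (Sum.elim
      (fun e => node (Sum.inr e) (C.row (C.lo e)) - node (Sum.inl (C.lo e)) 0)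
      (fun e => node (Sum.inr e) (C.row (C.hi e)) - node (Sum.inl (C.hi e)) 0))
  rcases exists_pos_or_exists_nonneg_combination a b with ⟨y, hb, ha⟩ | ⟨c, m, hc, hc0, hcm⟩
  · have hline : ∀ e r, C.Transit e r → y.2 e r = C.line y.1 e r := by
      intro e r her
      have h1 : y.2 e (C.row (C.lo e)) = y.1 (C.lo e) := sub_eq_zero.mp (hb (Sum.inr (Sum.inl e)))
      have h2 : y.2 e (C.row (C.hi e)) = y.1 (C.hi e) := sub_eq_zero.mp (hb (Sum.inr (Sum.inr e)))
      rw [eq_affine_of_second_difference (g := y.2 e)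
        (fun r h h' => hb (Sum.inl ⟨e, r, Finset.mem_Ioo.mpr ⟨h, h'⟩⟩)) her.1.le her.2.le
        (C.row_lt e), h1, h2, line]
    have hnode : ∀ n r, C.Alive n r → node n r (C.straight y.1) = node n r y := by
      rintro (v | e) r h
      · rfl
      · exact (hline e r h).symm
    refine ⟨y.1, fun r n n' hn hn' hlt => ?_⟩
    rw [hnode n r hn, hnode n' r hn']
    exact sub_pos.mp (ha ⟨(n, n', r), hn, hn', hlt⟩)
  · exfalso
    let M : E → ℤ → ℝ := fun e r =>
      if h : r ∈ T e then m (Sum.inl ⟨e, r, h⟩) else 0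
    have hM0 : ∀ e r, r ∉ T e → M e r = 0 := fun e r h => dif_neg h
    have hsum : ∀ y : (V → ℝ) × (E → ℤ → ℝ), (∀ e, y.2 e (C.row (C.lo e)) = y.1 (C.lo e)) →
        (∀ e, y.2 e (C.row (C.hi e)) = y.1 (C.hi e)) →
        ∑ i, c i * a i y = ∑ e, ∑ r ∈ T e, M e r * bend e r y := by
      intro y h1 h2
      rw [hcm y, Fintype.sum_sum_type, Fintype.sum_sum_type, Fintype.sum_sigma]
      have e1 : ∀ e, b (Sum.inr (Sum.inl e)) y = 0 := fun e => sub_eq_zero.mpr (h1 e)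
      have e2 : ∀ e, b (Sum.inr (Sum.inr e)) y = 0 := fun e => sub_eq_zero.mpr (h2 e)
      simp only [e1, e2, mul_zero, Finset.sum_const_zero, add_zero]
      refine Finset.sum_congr rfl fun e _ => ?_
      rw [← Finset.sum_coe_sort (T e)]
      refine Finset.sum_congr rfl fun r _ => ?_
      simp only [M, dif_pos r.2]
      rfl
    let S : C.Stress :=
      { M := M
        M_zero := fun e r h => hM0 e r fun h' => h (Finset.mem_Ioo.mp h')
        conc := by
          intro r φ hφ
          let y : (V → ℝ) × (E → ℤ → ℝ) :=
            (fun v => if C.row v = r then φ (C.x v) else 0,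
              fun e s => if s = r then φ (C.p e s) else 0)
          have hy := hsum y (fun e => by simp [y, C.p_lo]) (fun e => by simp [y, C.p_hi])
          have hn : ∀ n s, C.Alive n s →
              node n s y = if s = r then φ (node n s C.coords) else 0 := by
            rintro (v | e) s h
            · obtain rfl : C.row v = s := h
              rfl
            · rfl
          have hle : ∑ i, c i * a i y ≤ 0 := by
            refine Finset.sum_nonpos fun i _ => mul_nonpos_of_nonneg_of_nonpos (hc i) ?_
            obtain ⟨⟨n, n', s⟩, h, h', hlt⟩ := i
            change node n' s y - node n s y ≤ 0
            rw [hn n s h, hn n' s h']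
            split_ifs
            · exact sub_nonpos.mpr (hφ hlt.le)
            · simp
          rw [hy] at hle
          refine le_trans (le_of_eq (Finset.sum_congr rfl fun e _ => ?_)) hle
          have hd : ∀ s, ∑ t ∈ T e, M e t * (if t = s then φ (C.p e r) else 0) =
              M e s * φ (C.p e r) := by
            intro s
            simp only [mul_ite, mul_zero, Finset.sum_ite_eq']
            split_ifs with hs
            · rfl
            · rw [hM0 e s hs, zero_mul]
          have hb : ∀ t, bend e t y = (if t = r - 1 then φ (C.p e r) else 0) -
              2 * (if t = r then φ (C.p e r) else 0) +
              (if t = r + 1 then φ (C.p e r) else 0) := by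
            intro t
            simp only [bend_apply, y]
            congr 1
            · congr 1
              · by_cases h : t + 1 = r
                · rw [if_pos h, if_pos (by omega), h]
                · rw [if_neg h, if_neg (by omega)]
              · by_cases h : t = r
                · rw [if_pos h, if_pos h, h]
                · rw [if_neg h, if_neg h]
            · by_cases h : t - 1 = r
              · rw [if_pos h, if_pos (by omega), h]
              · rw [if_neg h, if_neg (by omega)]
          simp only [hb, mul_add, mul_sub, Finset.sum_add_distrib, Finset.sum_sub_distrib,
            mul_left_comm _ (2 : ℝ), ← Finset.mul_sum, hd]
          ring }
    have hM : ∀ e r, M e r = 0 := S.M_eq_zero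
    have h0 := hsum C.coords C.p_lo C.p_hi
    simp only [hM, zero_mul, Finset.sum_const_zero] at h0
    have hpos : ∀ i, 0 < a i C.coords := fun i => sub_pos.mpr i.2.2.2
    rw [Finset.sum_eq_zero_iff_of_nonneg fun i _ => mul_nonneg (hc i) (hpos i).le] at h0
    exact hc0 (funext fun i => (mul_eq_zero.mp (h0 i (Finset.mem_univ i))).resolve_right
      (hpos i).ne')

end Straightening

end LevelDrawing

namespace LevelDrawing

variable {V E : Type} {C : LevelDrawing V E}

lemma Alive.eq_of_node_eq {a b : V ⊕ E} {r : ℤ} (ha : C.Alive a r) (hb : C.Alive b r)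
    (h : node a r C.coords = node b r C.coords) : a = b := by
  rcases a with v | e <;> rcases b with w | f
  · exact congrArg _ (C.x_inj v w (Eq.trans ha (Eq.symm hb)) h)
  · obtain rfl : C.row v = r := ha
    exact absurd h.symm (C.p_ne_x f v hb.1 hb.2)
  · obtain rfl : C.row w = r := hb
    exact absurd h (C.p_ne_x e w ha.1 ha.2)
  · exact congrArg _ (C.p_inj e f r ha.1 ha.2 hb.1 hb.2 h)

/-- The coordinates `Y` preserve the order of the nodes on every row. -/
def Straightens (C : LevelDrawing V E) (Y : V → ℝ) : Prop :=
  ∀ r a b, C.Alive a r → C.Alive b r → node a r C.coords < node b r C.coords →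
    node a r (C.straight Y) < node b r (C.straight Y)

lemma Straightens.le_iff {Y : V → ℝ} (hY : C.Straightens Y) {a b : V ⊕ E} {r : ℤ}
    (ha : C.Alive a r) (hb : C.Alive b r) :
    node a r (C.straight Y) ≤ node b r (C.straight Y) ↔ node a r C.coords ≤ node b r C.coords := by
  constructor
  · intro h
    by_contra! hc
    exact absurd h (hY r b a hb ha hc).not_ge
  · intro h
    rcases h.lt_or_eq with h | h
    · exact (hY r a b ha hb h).le
    · rw [ha.eq_of_node_eq hb h]

lemma Straightens.lt_iff {Y : V → ℝ} (hY : C.Straightens Y) {a b : V ⊕ E} {r : ℤ}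
    (ha : C.Alive a r) (hb : C.Alive b r) :
    node a r (C.straight Y) < node b r (C.straight Y) ↔ node a r C.coords < node b r C.coords :=
  lt_iff_lt_of_le_iff_le (hY.le_iff hb ha)

lemma line_lo (C : LevelDrawing V E) (Y : V → ℝ) (e : E) :
    C.line Y e (C.row (C.lo e)) = Y (C.lo e) := by
  simp [line]

lemma row_sub_ne_zero (C : LevelDrawing V E) (e : E) :
    (C.row (C.hi e) : ℝ) - C.row (C.lo e) ≠ 0 :=
  sub_ne_zero.mpr (by exact_mod_cast (C.row_lt e).ne')

lemma line_hi (C : LevelDrawing V E) (Y : V → ℝ) (e : E) :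
    C.line Y e (C.row (C.hi e)) = Y (C.hi e) := by
  rw [line, div_self (C.row_sub_ne_zero e)]
  ring

lemma line_combo (C : LevelDrawing V E) (Y : V → ℝ) (e : E) (t s : ℝ) :
    C.line Y e (t + s) = (1 - s) * C.line Y e t + s * C.line Y e (t + 1) := by
  simp only [line]
  have := C.row_sub_ne_zero e
  field_simp
  ring

lemma Meets.exists_node {e : E} {r : ℤ} (h : C.Meets e r) :
    ∃ n, C.Alive n r ∧ (n = Sum.inl (C.lo e) ∨ n = Sum.inl (C.hi e) ∨ n = Sum.inr e) ∧
      node n r C.coords = C.p e r ∧ ∀ Y, node n r (C.straight Y) = C.line Y e r := by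
  rcases h.1.eq_or_lt with h1 | h1
  · subst h1
    exact ⟨Sum.inl (C.lo e), rfl, Or.inl rfl, (C.p_lo e).symm, fun Y => (C.line_lo Y e).symm⟩
  rcases h.2.eq_or_lt with h2 | h2
  · subst h2
    exact ⟨Sum.inl (C.hi e), rfl, Or.inr (Or.inl rfl), (C.p_hi e).symm,
      fun Y => (C.line_hi Y e).symm⟩
  · exact ⟨Sum.inr e, ⟨h1, h2⟩, Or.inr (Or.inr rfl), rfl, fun Y => rfl⟩

lemma Straightens.line_le {Y : V → ℝ} (hY : C.Straightens Y) {e f : E} {r : ℤ}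
    (he : C.Meets e r) (hf : C.Meets f r) (h : C.p e r ≤ C.p f r) :
    C.line Y e r ≤ C.line Y f r := by
  obtain ⟨n, hn, -, h1, h2⟩ := he.exists_node
  obtain ⟨m, hm, -, h3, h4⟩ := hf.exists_node
  rw [← h2, ← h4, hY.le_iff hn hm, h1, h3]
  exact h

lemma Straightens.line_lt {Y : V → ℝ} (hY : C.Straightens Y) {e f : E} {r : ℤ}
    (he : C.Meets e r) (hf : C.Meets f r) (h : C.p e r < C.p f r) :
    C.line Y e r < C.line Y f r := by
  obtain ⟨n, hn, -, h1, h2⟩ := he.exists_node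
  obtain ⟨m, hm, -, h3, h4⟩ := hf.exists_node
  rw [← h2, ← h4, hY.lt_iff hn hm, h1, h3]
  exact h

lemma eq_of_p_eq {e f : E} {r : ℤ} (he : C.Meets e r) (he' : C.Meets e (r + 1))
    (hf : C.Meets f r) (hf' : C.Meets f (r + 1)) (h : C.p e r = C.p f r)
    (h' : C.p e (r + 1) = C.p f (r + 1)) : e = f := by
  by_contra hne
  have hnt : ∀ s, C.Meets e s → C.Meets f s → C.p e s = C.p f s →
      ∃ v, C.row v = s ∧ (v = C.lo e ∨ v = C.hi e) ∧ (v = C.lo f ∨ v = C.hi f) := by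
    intro s he hf h
    obtain ⟨n, hn, hne', h1, -⟩ := he.exists_node
    obtain ⟨m, hm, hmf, h3, -⟩ := hf.exists_node
    obtain rfl : n = m := hn.eq_of_node_eq hm (by rw [h1, h3, h])
    rcases n with v | g
    · exact ⟨v, hn, by simpa using hne', by simpa using hmf⟩
    · have h5 : g = e := by simpa using hne'
      have h6 : g = f := by simpa using hmf
      exact absurd (h5.symm.trans h6) hne
  obtain ⟨v, hv, hve, hvf⟩ := hnt r he hf h
  obtain ⟨w, hw, hwe, hwf⟩ := hnt (r + 1) he' hf' h'
  have h1 := he'.2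
  have h2 := hf'.2
  have h3 := he.1
  have h4 := hf.1
  have hve' : v = C.lo e := hve.resolve_right (by rintro rfl; omega)
  have hvf' : v = C.lo f := hvf.resolve_right (by rintro rfl; omega)
  have hwe' : w = C.hi e := hwe.resolve_left (by rintro rfl; omega)
  have hwf' : w = C.hi f := hwf.resolve_left (by rintro rfl; omega)
  exact hne (C.simple e f (hve'.symm.trans hvf') (hwe'.symm.trans hwf'))

/-- Straightened edges do not cross between two consecutive rows. -/
lemma Straightens.line_ne {Y : V → ℝ} (hY : C.Straightens Y) {e f : E} (hne : e ≠ f) {r : ℤ}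
    (he : C.Meets e r) (he' : C.Meets e (r + 1)) (hf : C.Meets f r) (hf' : C.Meets f (r + 1))
    {s : ℝ} (hs : 0 < s) (hs' : s < 1) : C.line Y e (r + s) ≠ C.line Y f (r + s) := by
  have main : ∀ e f, e ≠ f → C.Meets e r → C.Meets e (r + 1) → C.Meets f r → C.Meets f (r + 1) →
      C.p e r ≤ C.p f r → C.p e (r + 1) ≤ C.p f (r + 1) →
      C.line Y e (r + s) < C.line Y f (r + s) := by
    intro e f hne he he' hf hf' h h'
    have i1 := hY.line_le he hf h
    have i2 := hY.line_le he' hf' h'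
    rw [line_combo, line_combo C Y f]
    push_cast at i2
    rcases h.lt_or_eq with hlt | heq
    · have := hY.line_lt he hf hlt
      nlinarith
    · have := hY.line_lt he' hf' (h'.lt_of_ne fun h' => hne (eq_of_p_eq he he' hf hf' heq h'))
      push_cast at this
      nlinarith
  rcases lt_trichotomy (C.p e r) (C.p f r) with h | h | h
  · exact (main e f hne he he' hf hf' h.le (C.noncross e f r he.1 he'.2 hf.1 hf'.2 h)).ne
  · rcases le_total (C.p e (r + 1)) (C.p f (r + 1)) with h' | h'
    · exact (main e f hne he he' hf hf' h.le h').ne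
    · exact (main f e hne.symm hf hf' he he' h.ge h').ne'
  · exact (main f e hne.symm hf hf' he he' h.le (C.noncross f e r hf.1 hf'.2 he.1 he'.2 h)).ne'

end LevelDrawing

/-- `S` behaves like a `y`-monotone path from `p` up to `q` that is straight between any two
consecutive integer heights. -/
structure IsMonotoneArc (S : Set Pt) (p q : Pt) : Prop where
  le : p.2 ≤ q.2
  left_mem : p ∈ S
  right_mem : q ∈ S
  mem_Icc : ∀ z ∈ S, z.2 ∈ Icc p.2 q.2
  nonempty : ∀ t ∈ Icc p.2 q.2, (rowSlice S t).Nonempty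
  ordConnected : ∀ t, (rowSlice S t).OrdConnected
  strip : ∀ r : ℤ, p.2 ≤ r → (r : ℝ) + 1 ≤ q.2 →
    ∃ a b : ℝ, segment ℝ ((a, (r : ℝ)) : Pt) (b, (r : ℝ) + 1) ⊆ S

lemma snd_mem_Icc_of_mem_segment {p q z : Pt} (h : p.2 ≤ q.2) (hz : z ∈ segment ℝ p q) :
    z.2 ∈ Icc p.2 q.2 := by
  obtain ⟨a, b, ha, hb, hab, rfl⟩ := hz
  rw [← segment_eq_Icc h]
  exact ⟨a, b, ha, hb, hab, rfl⟩

lemma exists_mem_segment_snd_eq {p q : Pt} {t : ℝ} (h : t ∈ Icc p.2 q.2) :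
    ∃ x, (x, t) ∈ segment ℝ p q := by
  rw [← segment_eq_Icc (h.1.trans h.2)] at h
  obtain ⟨a, b, ha, hb, hab, rfl⟩ := h
  exact ⟨a * p.1 + b * q.1, a, b, ha, hb, hab, rfl⟩

lemma Convex.ordConnected_rowSlice {S : Set Pt} (hS : Convex ℝ S) (t : ℝ) :
    (rowSlice S t).OrdConnected := by
  refine ⟨fun x hx y hy z hz => ?_⟩
  have hxy := hz.1.trans hz.2
  rw [← segment_eq_Icc hxy] at hz
  obtain ⟨a, b, ha, hb, hab, rfl⟩ := hz
  have := hS hx hy ha hb hab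
  have e : a • ((x, t) : Pt) + b • (y, t) = (a • x + b • y, t) := by
    ext
    · simp
    · simp [← add_mul, hab]
  rwa [e] at this

lemma isMonotoneArc_segment {p q : Pt} (h : p.2 ≤ q.2) : IsMonotoneArc (segment ℝ p q) p q where
  le := h
  left_mem := left_mem_segment ℝ p q
  right_mem := right_mem_segment ℝ p q
  mem_Icc _ := snd_mem_Icc_of_mem_segment h
  nonempty _ := exists_mem_segment_snd_eq
  ordConnected := (convex_segment p q).ordConnected_rowSlice
  strip r h1 h2 := by
    obtain ⟨a, ha⟩ := exists_mem_segment_snd_eq (p := p) (q := q) (t := r)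
      ⟨h1, by linarith⟩
    obtain ⟨b, hb⟩ := exists_mem_segment_snd_eq (p := p) (q := q) (t := r + 1)
      ⟨by linarith, h2⟩
    exact ⟨a, b, (convex_segment p q).segment_subset ha hb⟩

lemma Set.OrdConnected.union_of_mem {s t : Set ℝ} (hs : s.OrdConnected) (ht : t.OrdConnected)
    {x : ℝ} (hxs : x ∈ s) (hxt : x ∈ t) : (s ∪ t).OrdConnected :=
  (hs.isPreconnected.union x hxs hxt ht.isPreconnected).ordConnected

/-- Concatenation of monotone arcs meeting at an integer height. -/
lemma IsMonotoneArc.union {S T : Set Pt} {p q z : Pt} (hS : IsMonotoneArc S p q)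
    (hT : IsMonotoneArc T q z) (hq : ∃ k : ℤ, q.2 = k) : IsMonotoneArc (S ∪ T) p z where
  le := hS.le.trans hT.le
  left_mem := Or.inl hS.left_mem
  right_mem := Or.inr hT.right_mem
  mem_Icc := by
    rintro w (hw | hw)
    · exact ⟨(hS.mem_Icc w hw).1, (hS.mem_Icc w hw).2.trans hT.le⟩
    · exact ⟨hS.le.trans (hT.mem_Icc w hw).1, (hT.mem_Icc w hw).2⟩
  nonempty t ht := by
    rcases le_total t q.2 with h | h
    · exact (hS.nonempty t ⟨ht.1, h⟩).mono fun _ => Or.inl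
    · exact (hT.nonempty t ⟨h, ht.2⟩).mono fun _ => Or.inr
  ordConnected t := by
    change (rowSlice S t ∪ rowSlice T t).OrdConnected
    rcases lt_trichotomy t q.2 with h | rfl | h
    · have : rowSlice T t = ∅ := eq_empty_of_forall_notMem fun x hx =>
        h.not_ge (hT.mem_Icc _ hx).1
      rw [this, union_empty]
      exact hS.ordConnected t
    · exact (hS.ordConnected _).union_of_mem (hT.ordConnected _) hS.right_mem hT.left_mem
    · have : rowSlice S t = ∅ := eq_empty_of_forall_notMem fun x hx =>
        h.not_ge (hS.mem_Icc _ hx).2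
      rw [this, empty_union]
      exact hT.ordConnected t
  strip r h1 h2 := by
    obtain ⟨k, hk⟩ := hq
    rcases le_or_gt (r + 1) k with h | h
    · obtain ⟨a, b, hab⟩ := hS.strip r h1 (by rw [hk]; exact_mod_cast h)
      exact ⟨a, b, hab.trans subset_union_left⟩
    · obtain ⟨a, b, hab⟩ := hT.strip r (by rw [hk]; exact_mod_cast Int.lt_add_one_iff.mp h) h2
      exact ⟨a, b, hab.trans subset_union_right⟩

lemma isMonotoneArc_chainSet (l : List Pt) : ∀ p z : Pt, (p :: l).getLast? = some z →
    ((p :: l).map Prod.snd).IsChain (· ≤ ·) → (∀ q ∈ p :: l, ∃ k : ℤ, q.2 = k) →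
    IsMonotoneArc (chainSet (p :: l)) p z := by
  induction l with
  | nil =>
    intro p z hz _ _
    obtain rfl : p = z := by simpa using hz
    have := isMonotoneArc_segment (le_refl p.2)
    rwa [segment_same] at this
  | cons q l ih =>
    intro p z hz hc hi
    rw [List.map_cons, List.map_cons, List.isChain_cons_cons] at hc
    refine (isMonotoneArc_segment hc.1).union (ih q z (by simpa using hz) hc.2
      fun w hw => hi w (List.mem_cons_of_mem _ hw)) (hi q (by simp))

lemma chainSet_append_pair (l : List Pt) (a b : Pt) :
    chainSet (l ++ [a, b]) = chainSet (l ++ [a]) ∪ segment ℝ a b := by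
  induction l with
  | nil =>
    have h1 : {b} ⊆ segment ℝ a b := singleton_subset_iff.mpr (right_mem_segment ℝ a b)
    have h2 : {a} ⊆ segment ℝ a b := singleton_subset_iff.mpr (left_mem_segment ℝ a b)
    simp only [List.nil_append, chainSet]
    rw [union_eq_self_of_subset_right h1, union_eq_self_of_subset_left h2]
  | cons c l ih =>
    cases l with
    | nil =>
      simp only [List.nil_append, List.cons_append, chainSet] at ih ⊢
      rw [ih, union_assoc]
    | cons d l =>
      simp only [List.cons_append, chainSet] at ih ⊢
      rw [ih, union_assoc]

lemma chainSet_reverse (l : List Pt) : chainSet l.reverse = chainSet l := by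
  induction l with
  | nil => rfl
  | cons a l ih =>
    cases l with
    | nil => rfl
    | cons b l =>
      rw [List.reverse_cons, List.reverse_cons, List.append_assoc, List.singleton_append,
        chainSet_append_pair, ← List.reverse_cons, ih, chainSet, segment_symm, union_comm]

/-- The endpoints of an integral `y`-monotone chain, ordered by height. -/
lemma isMonotoneArc_of_isChain {l : List Pt} {p q : Pt} (hp : l.head? = some p)
    (hq : l.getLast? = some q)
    (hc : (l.map Prod.snd).IsChain (· ≤ ·) ∨ (l.map Prod.snd).IsChain (· ≥ ·))
    (hi : ∀ z ∈ l, ∃ k : ℤ, z.2 = k) :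
    IsMonotoneArc (chainSet l) p q ∨ IsMonotoneArc (chainSet l) q p := by
  rcases hc with hc | hc
  · left
    cases l with
    | nil => simp at hp
    | cons a l =>
      obtain rfl : a = p := by simpa using hp
      exact isMonotoneArc_chainSet l a q hq hc hi
  · right
    rw [← chainSet_reverse]
    have hr : l.reverse.head? = some q := by rwa [List.head?_reverse]
    have hr' : l.reverse.getLast? = some p := by rwa [List.getLast?_reverse]
    have hi' : ∀ z ∈ l.reverse, ∃ k : ℤ, z.2 = k := fun z hz => hi z (List.mem_reverse.mp hz)
    have hc' : (l.reverse.map Prod.snd).IsChain (· ≤ ·) := by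
      rw [List.map_reverse, List.isChain_reverse]
      exact hc
    generalize l.reverse = m at *
    cases m with
    | nil => simp at hr
    | cons a m =>
      obtain rfl : a = q := by simpa using hr
      exact isMonotoneArc_chainSet m a p hr' hc' hi'

lemma mem_chainBends {l : List Pt} {p q z : Pt} (hp : l.head? = some p)
    (hq : l.getLast? = some q) (hz : z ∈ l) : z = p ∨ z = q ∨ z ∈ chainBends l := by
  cases l with
  | nil => simp at hz
  | cons a l =>
    obtain rfl : a = p := by simpa using hp
    rcases List.mem_cons.mp hz with rfl | hz
    · exact Or.inl rfl
    · have hne : l ≠ [] := List.ne_nil_of_mem hz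
      rw [← List.dropLast_append_getLast hne] at hz
      have hl : l.getLast hne = q := by
        rw [List.getLast?_cons_of_ne_nil hne, List.getLast?_eq_getLast_of_ne_nil hne] at hq
        simpa using hq
      rcases List.mem_append.mp hz with hz | hz
      · exact Or.inr (Or.inr (by simpa [chainBends] using hz))
      · exact Or.inr (Or.inl (by simpa [hl] using hz))

namespace PolyDrawing

variable {V : Type} {G : SimpleGraph V}

lemma exists_isMonotoneArc {Γ : PolyDrawing G} (hmono : Γ.IsYMonotone) (hint : Γ.IntegerY)
    (e : G.edgeSet) : ∃ q : V × V, e.1 = s(q.1, q.2) ∧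
      IsMonotoneArc (Γ.edgePts e) (Γ.pos q.1) (Γ.pos q.2) := by
  obtain ⟨e, he⟩ := e
  induction e using Sym2.ind with
  | h u v =>
    have key : ∀ u v : V, s(u, v) ∈ G.edgeSet →
        (Γ.arc s(u, v)).head? = some (Γ.pos u) → (Γ.arc s(u, v)).getLast? = some (Γ.pos v) →
        IsMonotoneArc (Γ.edgePts s(u, v)) (Γ.pos u) (Γ.pos v) ∨
          IsMonotoneArc (Γ.edgePts s(u, v)) (Γ.pos v) (Γ.pos u) := by
      intro u v he hu hv
      refine isMonotoneArc_of_isChain hu hv (hmono _ he) fun z hz => ?_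
      rcases mem_chainBends hu hv hz with rfl | rfl | hz
      · exact hint.1 u
      · exact hint.1 v
      · exact hint.2 _ he z hz
    have sw : s(u, v) = s(v, u) := Sym2.eq_swap
    rcases Γ.arc_ends u v he with ⟨h1, h2⟩ | ⟨h1, h2⟩
    · rcases key u v he h1 h2 with h | h
      · exact ⟨(u, v), rfl, h⟩
      · exact ⟨(v, u), sw, h⟩
    · rw [sw] at h1 h2
      have h3 := key v u (sw ▸ he) h1 h2
      rw [← sw] at h3
      rcases h3 with h | h
      · exact ⟨(v, u), sw, h⟩
      · exact ⟨(u, v), rfl, h⟩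

end PolyDrawing

/-- Two disjoint intervals of the line are ordered like any two of their points. -/
lemma Set.OrdConnected.lt_of_lt {s t : Set ℝ} (hs : s.OrdConnected) (ht : t.OrdConnected)
    (hd : ∀ x ∈ s, x ∉ t) {a b : ℝ} (ha : a ∈ s) (hb : b ∈ t) (hab : a < b) :
    ∀ x ∈ s, ∀ y ∈ t, x < y := by
  intro x hx y hy
  by_contra! hc
  rcases le_or_gt a y with h | h
  · exact hd y (hs.out ha hx ⟨h, hc⟩) hy
  · exact hd a ha (ht.out hy hb ⟨h.le, hab.le⟩)

/-- A planar drawing whose vertices lie on integer rows and whose edges are monotone arcs that are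
straight between consecutive rows. -/
structure RowDrawing {V : Type} (G : SimpleGraph V) where
  row : V → ℤ
  x : V → ℝ
  lo : G.edgeSet → V
  hi : G.edgeSet → V
  eq_ends : ∀ e, e.1 = s(lo e, hi e)
  draw : V ⊕ G.edgeSet → Set Pt
  draw_inl : ∀ v, draw (Sum.inl v) = {(x v, (row v : ℝ))}
  arc : ∀ e, IsMonotoneArc (draw (Sum.inr e)) (x (lo e), (row (lo e) : ℝ))
    (x (hi e), (row (hi e) : ℝ))
  inj : ∀ v w, row v = row w → x v = x w → v = w
  planar : ∀ a b, a ≠ b → ∀ z ∈ draw a, z ∈ draw b →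
    ∃ w, (a = Sum.inl w ∨ ∃ e, a = Sum.inr e ∧ w ∈ e.1) ∧
      (b = Sum.inl w ∨ ∃ e, b = Sum.inr e ∧ w ∈ e.1) ∧ z = (x w, (row w : ℝ))

namespace RowDrawing

variable {V : Type} {G : SimpleGraph V} (D : RowDrawing G)

/-- The edges that are not drawn horizontally. -/
abbrev Sloped : Type := {e : G.edgeSet // D.row (D.lo e) < D.row (D.hi e)}

lemma mem_iff {e : G.edgeSet} {v : V} : v ∈ e.1 ↔ v = D.lo e ∨ v = D.hi e := by
  rw [D.eq_ends e, Sym2.mem_iff]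

lemma row_le (e : G.edgeSet) : D.row (D.lo e) ≤ D.row (D.hi e) :=
  Int.cast_le.mp (D.arc e).le

lemma ordConnected (a : V ⊕ G.edgeSet) (t : ℝ) : (rowSlice (D.draw a) t).OrdConnected := by
  rcases a with v | e
  · rw [D.draw_inl]
    exact (convex_singleton _).ordConnected_rowSlice t
  · exact (D.arc e).ordConnected t

open Classical in
/-- A crossing of the edge `e` with row `r`. -/
def crossing (e : G.edgeSet) (r : ℤ) : ℝ :=
  if r = D.row (D.lo e) then D.x (D.lo e) else if r = D.row (D.hi e) then D.x (D.hi e) else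
    if h : (rowSlice (D.draw (Sum.inr e)) r).Nonempty then h.some else 0

lemma crossing_mem {e : G.edgeSet} {r : ℤ} (h : D.row (D.lo e) ≤ r) (h' : r ≤ D.row (D.hi e)) :
    D.crossing e r ∈ rowSlice (D.draw (Sum.inr e)) r := by
  unfold crossing
  split_ifs with h1 h2 h3
  · subst h1
    exact (D.arc e).left_mem
  · subst h2
    exact (D.arc e).right_mem
  · exact h3.some_mem
  · exact absurd ((D.arc e).nonempty r ⟨Int.cast_le.mpr h, Int.cast_le.mpr h'⟩) h3

lemma crossing_lo (e : G.edgeSet) : D.crossing e (D.row (D.lo e)) = D.x (D.lo e) := if_pos rfl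

lemma crossing_hi (e : D.Sloped) : D.crossing e.1 (D.row (D.hi e.1)) = D.x (D.hi e.1) := by
  rw [crossing, if_neg e.2.ne', if_pos rfl]

/-- The vertex `w` belongs to the vertex or edge `a`. -/
def Incident (a : V ⊕ G.edgeSet) (w : V) : Prop :=
  a = Sum.inl w ∨ ∃ e, a = Sum.inr e ∧ w ∈ e.1

@[simp] lemma incident_inl {v w : V} : Incident (G := G) (Sum.inl v) w ↔ v = w := by
  simp [Incident]

@[simp] lemma incident_inr {e : G.edgeSet} {w : V} : Incident (Sum.inr e) w ↔ w ∈ e.1 := by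
  simp [Incident]

lemma Incident.eq_of_incident {a b : V ⊕ G.edgeSet} (hab : a ≠ b) {v w : V} (hv : Incident a v)
    (hv' : Incident b v) (hw : Incident a w) (hw' : Incident b w) : v = w := by
  rcases a with u | e <;> rcases b with u' | f <;>
    simp only [incident_inl, incident_inr] at hv hv' hw hw'
  · exact hv.symm.trans hw
  · exact hv.symm.trans hw
  · exact hv'.symm.trans hw'
  · by_contra hne
    refine hab (congrArg _ (Subtype.ext ?_))
    rw [(Sym2.mem_and_mem_iff hne).mp ⟨hv, hw⟩, (Sym2.mem_and_mem_iff hne).mp ⟨hv', hw'⟩]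

lemma exists_common {a b : V ⊕ G.edgeSet} (hab : a ≠ b) {r : ℤ} {t : ℝ}
    (ha : t ∈ rowSlice (D.draw a) r) (hb : t ∈ rowSlice (D.draw b) r) :
    ∃ w, Incident a w ∧ Incident b w ∧ D.row w = r ∧ D.x w = t := by
  obtain ⟨w, h1, h2, h3⟩ := D.planar a b hab _ ha hb
  rw [Prod.mk.injEq] at h3
  exact ⟨w, h1, h2, by exact_mod_cast h3.2.symm, h3.1.symm⟩

lemma crossing_lt {e f : G.edgeSet} {r : ℤ} (he : D.row (D.lo e) ≤ r) (he' : r ≤ D.row (D.hi e))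
    (hf : D.row (D.lo f) ≤ r) (hf' : r ≤ D.row (D.hi f))
    (hne : ∀ w, D.row w = r → w ∈ e.1 → w ∈ f.1 → D.crossing e r = D.crossing f r)
    (h : D.crossing e r < D.crossing f r) {a b : ℝ} (ha : a ∈ rowSlice (D.draw (Sum.inr e)) r)
    (hb : b ∈ rowSlice (D.draw (Sum.inr f)) r) : a < b := by
  refine (D.ordConnected _ _).lt_of_lt (D.ordConnected _ _) (fun t ht ht' => ?_)
    (D.crossing_mem he he') (D.crossing_mem hf hf') h a ha b hb
  have hef : Sum.inr (α := V) e ≠ Sum.inr f := by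
    rintro heq
    rw [Sum.inr_injective heq] at h
    exact lt_irrefl _ h
  obtain ⟨w, h1, h2, h3, -⟩ := D.exists_common hef ht ht'
  exact h.ne (hne w h3 (incident_inr.mp h1) (incident_inr.mp h2))

lemma crossing_noncross (e f : D.Sloped) (r : ℤ) (h1 : D.row (D.lo e.1) ≤ r)
    (h2 : r + 1 ≤ D.row (D.hi e.1)) (h3 : D.row (D.lo f.1) ≤ r) (h4 : r + 1 ≤ D.row (D.hi f.1))
    (h : D.crossing e.1 r < D.crossing f.1 r) :
    D.crossing e.1 (r + 1) ≤ D.crossing f.1 (r + 1) := by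
  by_contra! hc
  obtain ⟨a, b, hab⟩ := (D.arc e.1).strip r (by dsimp only; exact_mod_cast h1)
    (by dsimp only; exact_mod_cast h2)
  obtain ⟨c, d, hcd⟩ := (D.arc f.1).strip r (by dsimp only; exact_mod_cast h3)
    (by dsimp only; exact_mod_cast h4)
  have hac : a < c := by
    refine D.crossing_lt h1 (by omega) h3 (by omega) (fun w hw hwe hwf => ?_) h
      (hab (left_mem_segment ℝ _ _)) (hcd (left_mem_segment ℝ _ _))
    have e1 : w = D.lo e.1 := (D.mem_iff.mp hwe).resolve_right (by rintro rfl; omega)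
    have f1 : w = D.lo f.1 := (D.mem_iff.mp hwf).resolve_right (by rintro rfl; omega)
    have ce := D.crossing_lo e.1
    have cf := D.crossing_lo f.1
    rw [← e1, hw] at ce
    rw [← f1, hw] at cf
    rw [ce, cf]
  have hdb : d < b := by
    refine D.crossing_lt (r := r + 1) (by omega) h4 (by omega) h2 (fun w hw hwf hwe => ?_) hc
      (by simpa [rowSlice] using hcd (right_mem_segment ℝ _ _))
      (by simpa [rowSlice] using hab (right_mem_segment ℝ _ _))
    have e1 : w = D.hi e.1 := (D.mem_iff.mp hwe).resolve_left (by rintro rfl; omega)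
    have f1 : w = D.hi f.1 := (D.mem_iff.mp hwf).resolve_left (by rintro rfl; omega)
    have ce := D.crossing_hi e
    have cf := D.crossing_hi f
    rw [← e1, hw] at ce
    rw [← f1, hw] at cf
    rw [ce, cf]
  have hpos : 0 < (c - a) + (b - d) := by linarith
  let s := (c - a) / ((c - a) + (b - d))
  have hs0 : 0 < s := div_pos (by linarith) hpos
  have hs1 : s < 1 := (div_lt_one hpos).mpr (by linarith)
  have hs : s * ((c - a) + (b - d)) = c - a := div_mul_cancel₀ _ hpos.ne'
  have m1 : ((1 - s) * a + s * b, r + s) ∈ D.draw (Sum.inr e.1) :=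
    hab ⟨1 - s, s, by linarith, hs0.le, by ring, by ext <;> simp; ring⟩
  have m2 : ((1 - s) * a + s * b, r + s) ∈ D.draw (Sum.inr f.1) := by
    refine hcd ⟨1 - s, s, by linarith, hs0.le, by ring, ?_⟩
    ext
    · simp only [Prod.fst_add, Prod.smul_fst, smul_eq_mul]
      linarith
    · simp only [Prod.snd_add, Prod.smul_snd, smul_eq_mul]
      ring
  have hne : Sum.inr (α := V) e.1 ≠ Sum.inr f.1 := by
    intro heq
    rw [Sum.inr_injective heq] at h
    exact lt_irrefl _ h
  obtain ⟨w, -, -, hw⟩ := D.planar _ _ hne _ m1 m2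
  rw [Prod.mk.injEq] at hw
  have l1 : r < D.row w := by exact_mod_cast (show (r : ℝ) < D.row w by linarith [hw.2])
  have l2 : D.row w < r + 1 := by exact_mod_cast (show (D.row w : ℝ) < r + 1 by linarith [hw.2])
  omega

/-- The level drawing formed by the vertices and the sloped edges. -/
def level : LevelDrawing V D.Sloped where
  row := D.row
  lo e := D.lo e.1
  hi e := D.hi e.1
  x := D.x
  p e := D.crossing e.1
  row_lt e := e.2
  p_lo e := D.crossing_lo e.1
  p_hi := D.crossing_hi
  x_inj := D.inj
  p_ne_x e v h h' heq := by
    have hm := D.crossing_mem h.le h'.le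
    rw [heq] at hm
    obtain ⟨w, h1, h2, -⟩ := D.exists_common (a := Sum.inl v) (b := Sum.inr e.1) (by simp)
      (by rw [D.draw_inl]; exact mem_singleton _) hm
    rw [incident_inl] at h1
    subst h1
    rw [incident_inr, D.mem_iff] at h2
    rcases h2 with h2 | h2
    · rw [← h2] at h
      exact lt_irrefl _ h
    · rw [← h2] at h'
      exact lt_irrefl _ h'
  p_inj e f r h1 h2 h3 h4 heq := by
    by_contra hne
    have hm := D.crossing_mem h1.le h2.le
    have hm' := D.crossing_mem h3.le h4.le
    rw [← heq] at hm'
    obtain ⟨w, h5, -, h6, -⟩ := D.exists_common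
      (fun h => hne (Subtype.ext (Sum.inr_injective h))) hm hm'
    rw [incident_inr, D.mem_iff] at h5
    rcases h5 with rfl | rfl <;> omega
  simple e f h h' := Subtype.ext (Subtype.ext (by rw [D.eq_ends, D.eq_ends, h, h']))
  noncross := D.crossing_noncross

/-- The vertex or sloped edge `n` contributes to the vertex or edge `a`. -/
def IsNode : V ⊕ G.edgeSet → V ⊕ D.Sloped → Prop
  | a, Sum.inl w => Incident a w
  | a, Sum.inr e => a = Sum.inr e.1

lemma node_mem {a : V ⊕ G.edgeSet} {n : V ⊕ D.Sloped} {r : ℤ} (h : D.IsNode a n)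
    (hr : D.level.Alive n r) :
    LevelDrawing.node n r D.level.coords ∈ rowSlice (D.draw a) r := by
  rcases n with w | e
  · obtain rfl : D.row w = r := hr
    rcases a with v | e
    · obtain rfl := incident_inl.mp h
      rw [D.draw_inl]
      exact mem_singleton _
    · rcases D.mem_iff.mp (incident_inr.mp h) with rfl | rfl
      · exact (D.arc e).left_mem
      · exact (D.arc e).right_mem
  · obtain rfl : a = Sum.inr e.1 := h
    exact D.crossing_mem hr.1.le hr.2.le

/-- The drawing obtained by placing the vertices at the horizontal coordinates `Y` and drawing
all edges straight. -/
def drawStraight (Y : V → ℝ) : V ⊕ G.edgeSet → Set Pt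
  | Sum.inl v => {(Y v, (D.row v : ℝ))}
  | Sum.inr e => segment ℝ (Y (D.lo e), (D.row (D.lo e) : ℝ)) (Y (D.hi e), (D.row (D.hi e) : ℝ))

lemma eq_line {Y : V → ℝ} {e : D.Sloped} {z : Pt} (hz : z ∈ D.drawStraight Y (Sum.inr e.1)) :
    z.1 = D.level.line Y e z.2 := by
  obtain ⟨a, b, ha, hb, hab, rfl⟩ := hz
  obtain rfl : a = 1 - b := by linarith
  have := D.level.row_sub_ne_zero e
  simp only [LevelDrawing.line, Prod.fst_add, Prod.smul_fst, smul_eq_mul, Prod.snd_add,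
    Prod.smul_snd]
  field_simp
  simp only [level]
  ring

lemma line_mem (Y : V → ℝ) {e : D.Sloped} {r : ℤ} (h : D.level.Meets e r) :
    D.level.line Y e r ∈ rowSlice (D.drawStraight Y (Sum.inr e.1)) r := by
  obtain ⟨t, ht⟩ := exists_mem_segment_snd_eq (p := (Y (D.lo e.1), (D.row (D.lo e.1) : ℝ)))
    (q := (Y (D.hi e.1), (D.row (D.hi e.1) : ℝ))) (t := (r : ℝ))
    ⟨Int.cast_le.mpr h.1, Int.cast_le.mpr h.2⟩
  rw [← D.eq_line ht]
  exact ht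

lemma mem_Icc_of_mem {Y : V → ℝ} {e : G.edgeSet} {z : Pt}
    (hz : z ∈ D.drawStraight Y (Sum.inr e)) :
    z.2 ∈ Icc (D.row (D.lo e) : ℝ) (D.row (D.hi e)) :=
  snd_mem_Icc_of_mem_segment (Int.cast_le.mpr (D.row_le e)) hz

lemma node_straight_mem (Y : V → ℝ) {a : V ⊕ G.edgeSet} {n : V ⊕ D.Sloped} {r : ℤ}
    (h : D.IsNode a n) (hr : D.level.Alive n r) :
    LevelDrawing.node n r (D.level.straight Y) ∈ rowSlice (D.drawStraight Y a) r := by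
  rcases n with w | e
  · obtain rfl : D.row w = r := hr
    rcases a with v | e
    · obtain rfl := incident_inl.mp h
      exact mem_singleton _
    · rcases D.mem_iff.mp (incident_inr.mp h) with rfl | rfl
      · exact left_mem_segment ℝ _ _
      · exact right_mem_segment ℝ _ _
  · obtain rfl : a = Sum.inr e.1 := h
    exact D.line_mem Y (LevelDrawing.Transit.meets hr)

/-- The part on row `r` of a straightened element is spanned by its nodes. -/
lemma exists_nodes {Y : V → ℝ} {a : V ⊕ G.edgeSet} {r : ℤ} {t : ℝ}
    (ht : t ∈ rowSlice (D.drawStraight Y a) r) : ∃ m n, D.IsNode a m ∧ D.IsNode a n ∧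
      D.level.Alive m r ∧ D.level.Alive n r ∧ LevelDrawing.node m r (D.level.straight Y) ≤ t ∧
      t ≤ LevelDrawing.node n r (D.level.straight Y) := by
  rcases a with v | e
  · have h : (t, (r : ℝ)) = (Y v, (D.row v : ℝ)) := ht
    rw [Prod.mk.injEq] at h
    have hr : D.row v = r := by exact_mod_cast h.2.symm
    exact ⟨Sum.inl v, Sum.inl v, incident_inl.mpr rfl, incident_inl.mpr rfl, hr, hr, h.1.ge, h.1.le⟩
  · have hI := D.mem_Icc_of_mem ht
    have h1 : D.row (D.lo e) ≤ r := Int.cast_le.mp hI.1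
    have h2 : r ≤ D.row (D.hi e) := Int.cast_le.mp hI.2
    have hlo : D.IsNode (Sum.inr e) (Sum.inl (D.lo e)) :=
      incident_inr.mpr (D.mem_iff.mpr (Or.inl rfl))
    have hhi : D.IsNode (Sum.inr e) (Sum.inl (D.hi e)) :=
      incident_inr.mpr (D.mem_iff.mpr (Or.inr rfl))
    by_cases hs : D.row (D.lo e) < D.row (D.hi e)
    · obtain ⟨n, hn, hn', -, hl⟩ := LevelDrawing.Meets.exists_node (C := D.level) (e := ⟨e, hs⟩)
        ⟨h1, h2⟩
      have hne : D.IsNode (Sum.inr e) n := by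
        rcases hn' with rfl | rfl | rfl
        · exact hlo
        · exact hhi
        · rfl
      have heq : t = LevelDrawing.node n r (D.level.straight Y) := by
        rw [hl Y]
        exact D.eq_line (e := ⟨e, hs⟩) ht
      exact ⟨n, n, hne, hne, hn, hn, heq.ge, heq.le⟩
    · obtain ⟨p, q, hp, hq, hpq, h⟩ := ht
      have hx : p * Y (D.lo e) + q * Y (D.hi e) = t := congrArg Prod.fst h
      obtain rfl : p = 1 - q := by linarith
      have hl : D.level.Alive (Sum.inl (D.lo e)) r := show D.row (D.lo e) = r by omega
      have hh : D.level.Alive (Sum.inl (D.hi e)) r := show D.row (D.hi e) = r by omega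
      rcases le_total (Y (D.lo e)) (Y (D.hi e)) with hle | hle
      · exact ⟨_, _, hlo, hhi, hl, hh, show Y (D.lo e) ≤ t by nlinarith,
          show t ≤ Y (D.hi e) by nlinarith⟩
      · exact ⟨_, _, hhi, hlo, hh, hl, show Y (D.hi e) ≤ t by nlinarith,
          show t ≤ Y (D.lo e) by nlinarith⟩

variable {D} {Y : V → ℝ}

open LevelDrawing in
lemma exists_common_of_straightens (hY : D.level.Straightens Y) {a b : V ⊕ G.edgeSet}
    (hab : a ≠ b) {r : ℤ} {t : ℝ} (ha : t ∈ rowSlice (D.drawStraight Y a) r)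
    (hb : t ∈ rowSlice (D.drawStraight Y b) r) :
    ∃ w, Incident a w ∧ Incident b w ∧ D.row w = r ∧ Y w = t := by
  obtain ⟨m, n, hm, hn, hmr, hnr, hmt, hnt⟩ := D.exists_nodes ha
  obtain ⟨m', n', hm', hn', hmr', hnr', hmt', hnt'⟩ := D.exists_nodes hb
  have key : ∀ k, D.level.Alive k r →
      node m r D.level.coords ≤ node k r D.level.coords →
      node m' r D.level.coords ≤ node k r D.level.coords →
      node k r D.level.coords ≤ node n r D.level.coords →
      node k r D.level.coords ≤ node n' r D.level.coords →
      ∃ w, Incident a w ∧ Incident b w ∧ k = Sum.inl w := by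
    intro k hk h1 h2 h3 h4
    obtain ⟨w, hwa, hwb, hwr, hwx⟩ := D.exists_common hab
      ((D.ordConnected a r).out (D.node_mem hm hmr) (D.node_mem hn hnr) ⟨h1, h3⟩)
      ((D.ordConnected b r).out (D.node_mem hm' hmr') (D.node_mem hn' hnr') ⟨h2, h4⟩)
    exact ⟨w, hwa, hwb, hk.eq_of_node_eq (b := Sum.inl w) hwr hwx.symm⟩
  have i1 := (hY.le_iff hmr hnr).mp (hmt.trans hnt)
  have i2 := (hY.le_iff hmr hnr').mp (hmt.trans hnt')
  have i3 := (hY.le_iff hmr' hnr).mp (hmt'.trans hnt)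
  have i4 := (hY.le_iff hmr' hnr').mp (hmt'.trans hnt')
  have lower : ∃ w, Incident a w ∧ Incident b w ∧ D.level.Alive (Sum.inl w) r ∧ Y w ≤ t := by
    rcases le_total (node m r D.level.coords) (node m' r D.level.coords) with h | h
    · obtain ⟨w, hwa, hwb, rfl⟩ := key m' hmr' h le_rfl i3 i4
      exact ⟨w, hwa, hwb, hmr', hmt'⟩
    · obtain ⟨w, hwa, hwb, rfl⟩ := key m hmr le_rfl h i1 i2
      exact ⟨w, hwa, hwb, hmr, hmt⟩
  have upper : ∃ w, Incident a w ∧ Incident b w ∧ t ≤ Y w := by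
    rcases le_total (node n r D.level.coords) (node n' r D.level.coords) with h | h
    · obtain ⟨w, hwa, hwb, rfl⟩ := key n hnr i1 i3 le_rfl h
      exact ⟨w, hwa, hwb, hnt⟩
    · obtain ⟨w, hwa, hwb, rfl⟩ := key n' hnr' i2 i4 h le_rfl
      exact ⟨w, hwa, hwb, hnt'⟩
  obtain ⟨w, hwa, hwb, hwr, hwt⟩ := lower
  obtain ⟨w', hwa', hwb', hwt'⟩ := upper
  obtain rfl := hwa.eq_of_incident hab hwb hwa' hwb'
  exact ⟨w, hwa, hwb, hwr, le_antisymm hwt hwt'⟩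

lemma exists_sloped {a : V ⊕ G.edgeSet} {z : Pt} (hz : z ∈ D.drawStraight Y a)
    (hr : ∀ r : ℤ, z.2 ≠ r) : ∃ e : D.Sloped, a = Sum.inr e.1 ∧ D.level.Meets e ⌊z.2⌋ ∧
      D.level.Meets e (⌊z.2⌋ + 1) ∧ z.1 = D.level.line Y e z.2 := by
  rcases a with v | e
  · exact absurd (congrArg Prod.snd (show z = (Y v, (D.row v : ℝ)) from hz)) (hr _)
  · obtain ⟨h1, h2⟩ := D.mem_Icc_of_mem hz
    have h1' : D.row (D.lo e) ≤ ⌊z.2⌋ := Int.le_floor.mpr h1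
    have h2' : ⌊z.2⌋ < D.row (D.hi e) := Int.floor_lt.mpr (h2.lt_of_ne (hr _))
    exact ⟨⟨e, h1'.trans_lt h2'⟩, rfl, ⟨h1', h2'.le⟩, ⟨h1'.trans (by omega), h2'⟩,
      D.eq_line (e := ⟨e, h1'.trans_lt h2'⟩) hz⟩

/-- The straightened drawing is planar. -/
lemma planar_of_straightens (hY : D.level.Straightens Y) {a b : V ⊕ G.edgeSet} (hab : a ≠ b)
    {z : Pt} (ha : z ∈ D.drawStraight Y a) (hb : z ∈ D.drawStraight Y b) :
    ∃ w, Incident a w ∧ Incident b w ∧ z = (Y w, (D.row w : ℝ)) := by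
  by_cases hr : ∃ r : ℤ, z.2 = r
  · obtain ⟨r, hr⟩ := hr
    obtain ⟨t, s⟩ := z
    obtain rfl : s = r := hr
    obtain ⟨w, h1, h2, h3, h4⟩ := exists_common_of_straightens hY hab ha hb
    exact ⟨w, h1, h2, by rw [h3, h4]⟩
  · push Not at hr
    obtain ⟨e, rfl, he, he', hez⟩ := exists_sloped ha hr
    obtain ⟨f, rfl, hf, hf', hfz⟩ := exists_sloped hb hr
    have hef : e ≠ f := fun h => hab (by rw [h])
    have hpos : 0 < Int.fract z.2 :=
      (Int.fract_nonneg _).lt_of_ne fun h => hr ⌊z.2⌋ (by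
        have := Int.floor_add_fract z.2
        linarith)
    refine absurd ?_ (hY.line_ne hef he he' hf hf' hpos (Int.fract_lt_one _))
    rw [Int.floor_add_fract, ← hez, ← hfz]

/-- The straightened drawing has the same order in each row. -/
lemma sameRowOrder_of_straightens (hY : D.level.Straightens Y) :
    SameRowOrder D.draw (D.drawStraight Y) := by
  intro r a b _ _ ha hb
  constructor
  · intro h t ht t' ht'
    obtain ⟨-, n, -, hn, -, hnr, -, hnt⟩ := D.exists_nodes ht
    obtain ⟨m, -, hm, -, hmr, -, hmt, -⟩ := D.exists_nodes ht'
    exact (hnt.trans_lt ((hY.lt_iff hnr hmr).mpr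
      (h _ (D.node_mem hn hnr) _ (D.node_mem hm hmr)))).trans_le hmt
  · intro h
    obtain ⟨t, ht⟩ := ha
    obtain ⟨t', ht'⟩ := hb
    obtain ⟨n, -, hn, -, hnr, -, -, -⟩ := D.exists_nodes ht
    obtain ⟨m, -, hm, -, hmr, -, -, -⟩ := D.exists_nodes ht'
    have hsep : ∀ k, D.level.Alive k r → D.IsNode a k → D.IsNode b k → False := fun k hk h1 h2 =>
      lt_irrefl _ (h _ (D.node_straight_mem Y h1 hk) _ (D.node_straight_mem Y h2 hk))
    refine (D.ordConnected a r).lt_of_lt (D.ordConnected b r) (fun s hs hs' => ?_)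
      (D.node_mem hn hnr) (D.node_mem hm hmr) ((hY.lt_iff hnr hmr).mp
      (h _ (D.node_straight_mem Y hn hnr) _ (D.node_straight_mem Y hm hmr)))
    by_cases hab : a = b
    · subst hab
      exact hsep n hnr hn hn
    · obtain ⟨w, hwa, hwb, hwr, -⟩ := D.exists_common hab hs hs'
      exact hsep (Sum.inl w) hwr hwa hwb

end RowDrawing

/-- The row drawing underlying an integral planar `y`-monotone poly-line drawing. -/
lemma PolyDrawing.exists_rowDrawing {V : Type} {G : SimpleGraph V} {Γ : PolyDrawing G}
    (hpl : Γ.IsPlanar) (hmono : Γ.IsYMonotone) (hint : Γ.IntegerY) :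
    ∃ D : RowDrawing G, D.draw = Γ.drawSet ∧ ∀ v, (D.row v : ℝ) = (Γ.pos v).2 := by
  choose row hrow using hint.1
  choose q hq harc using PolyDrawing.exists_isMonotoneArc hmono hint
  have hpos : ∀ v, ((Γ.pos v).1, (row v : ℝ)) = Γ.pos v := fun v => by rw [← hrow]
  refine ⟨{
    row := row
    x := fun v => (Γ.pos v).1
    lo := fun e => (q e).1
    hi := fun e => (q e).2
    eq_ends := hq
    draw := Γ.drawSet
    draw_inl := fun v => by rw [hpos]; rfl
    arc := fun e => by rw [hpos, hpos]; exact harc e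
    inj := fun v w h h' => Γ.pos_inj (by rw [← hpos v, ← hpos w, h, h'])
    planar := ?_ }, rfl, fun v => (hrow v).symm⟩
  rintro (v | e) (w | f) hab z hz hz'
  · exact absurd (Γ.pos_inj ((mem_singleton_iff.mp hz).symm.trans (mem_singleton_iff.mp hz')))
      fun h => hab (congrArg _ h)
  · obtain rfl : z = Γ.pos v := hz
    exact ⟨v, Or.inl rfl, Or.inr ⟨f, rfl, by_contra fun h => hpl.1 v f f.2 h hz'⟩, (hpos v).symm⟩
  · obtain rfl : z = Γ.pos w := hz'
    exact ⟨w, Or.inr ⟨e, rfl, by_contra fun h => hpl.1 w e e.2 h hz⟩, Or.inl rfl, (hpos w).symm⟩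
  · obtain ⟨w, h1, h2, h3⟩ := hpl.2 e e.2 f f.2
      (fun h => hab (congrArg _ (Subtype.ext h))) z ⟨hz, hz'⟩
    exact ⟨w, Or.inr ⟨e, rfl, h1⟩, Or.inr ⟨f, rfl, h2⟩, h3.trans (hpos w).symm⟩

/-- A row drawing of a finite graph can be straightened out. -/
theorem RowDrawing.exists_straightDrawing {V : Type} [Fintype V] {G : SimpleGraph V}
    (D : RowDrawing G) : ∃ Γ' : StraightDrawing G, Γ'.IsPlanar ∧
      (∀ v : V, (Γ'.pos v).2 = D.row v) ∧ SameRowOrder D.draw Γ'.drawSet := by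
  have : Fintype D.Sloped := Fintype.ofFinite _
  obtain ⟨Y, hY⟩ := D.level.exists_straightening
  replace hY : D.level.Straightens Y := hY
  let Γ' : StraightDrawing G :=
    { pos := fun v => (Y v, (D.row v : ℝ))
      pos_inj := by
        intro v w h
        by_contra hne
        obtain ⟨u, h1, h2, -⟩ := planar_of_straightens hY (a := Sum.inl v) (b := Sum.inl w)
          (by simpa using hne) (mem_singleton _) (mem_singleton_iff.mpr h)
        rw [incident_inl] at h1 h2
        exact hne (h1.trans h2.symm) }
  have hdraw : Γ'.drawSet = D.drawStraight Y := by
    funext a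
    rcases a with v | e
    · rfl
    · change Γ'.edgePts e.1 = _
      rw [D.eq_ends e]
      rfl
  have hedge : ∀ e (he : e ∈ G.edgeSet), Γ'.edgePts e = D.drawStraight Y (Sum.inr ⟨e, he⟩) :=
    fun e he => congrFun hdraw (Sum.inr ⟨e, he⟩)
  refine ⟨Γ', ⟨fun v e he hv hz => ?_, fun e he f hf hef z hz => ?_⟩, fun v => rfl, ?_⟩
  · rw [hedge e he] at hz
    obtain ⟨w, h1, h2, -⟩ := planar_of_straightens hY (a := Sum.inl v) (b := Sum.inr ⟨e, he⟩)
      (by simp) (mem_singleton _) hz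
    rw [incident_inl] at h1
    rw [incident_inr, ← h1] at h2
    exact hv h2
  · rw [hedge e he, hedge f hf] at hz
    obtain ⟨w, h1, h2, h3⟩ := planar_of_straightens hY
      (by simpa using hef) hz.1 hz.2
    exact ⟨w, incident_inr.mp h1, incident_inr.mp h2, h3⟩
  · rw [hdraw]
    exact sameRowOrder_of_straightens hY

end

/-- Any planar `y`-monotone poly-line drawing of a triangulated graph
with integer `y`-coordinates of vertices and bends can be straightened out: there is a
planar straight-line drawing with the same `y`-coordinates of vertices and the same
left-to-right order in each row. -/
theorem stmt4 {V : Type} [Fintype V] (G : SimpleGraph V) (hG : IsTriangulated G)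
    (Γ : PolyDrawing G) (hpl : Γ.IsPlanar) (hmono : Γ.IsYMonotone)
    (hint : Γ.IntegerY) :
    ∃ Γ' : StraightDrawing G, Γ'.IsPlanar ∧
      (∀ v : V, (Γ'.pos v).2 = (Γ.pos v).2) ∧
      SameRowOrder Γ.drawSet Γ'.drawSet := by
  obtain ⟨D, hD, hrow⟩ := PolyDrawing.exists_rowDrawing hpl hmono hint
  obtain ⟨Γ', h1, h2, h3⟩ := D.exists_straightDrawing
  exact ⟨Γ', h1, fun v => (h2 v).trans (hrow v), hD ▸ h3⟩
end

section
/- Let d ≥ 1 and let x_u, x_1, …, x_d be integers with x_u ≥ 0. Put u = (x_u, 1), v = (0, 4), and a_j = (x_j, 3) for odd j, a_j = (x_j, 2) for even j. Suppose: (i) the point where the segment [u, v] meets the horizontal line y = 3 lies strictly to the left of a_1 (equivalently x_u/3 < x_1); (ii) for every even j ≤ d, the point where the segment [v, a_j] meets the line y = 3 lies strictly to the right of a_{j−1} (equivalently x_{j−1} < x_j/2); (iii) for every odd j with 3 ≤ j ≤ d, the point where the segment [u, a_j] meets the line y = 2 lies strictly to the right of a_{j−1} (equivalently x_{j−1} <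 (x_u + x_j)/2). Then 3·x_{2i−1} ≥ x_u + 2^{2i} − 3 whenever 2i−1 ≤ d, and 3·x_{2i} ≥ 2·x_u + 2^{2i+1} − 3 whenever 2i ≤ d; in particular x_d + 1 ≥ (x_u + 2^{d+1})/3 ≥ 2^{d+1}/3. -/
/-- With `u = (x_u, 1)`, `v = (0, 4)`, `a_j = (x_j, 3)` for odd `j` and
`a_j = (x_j, 2)` for even `j`: if the crossing of `[u,v]` with the line `y = 3` is
strictly left of `a_1` (i.e. `x_u/3 < x_1`), the crossing of `[v,a_j]` with `y = 3` is
strictly right of `a_{j-1}` for even `j ≤ d` (i.e. `x_{j-1} < x_j/2`), and the crossing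
of `[u,a_j]` with `y = 2` is strictly right of `a_{j-1}` for odd `3 ≤ j ≤ d`
(i.e. `x_{j-1} < (x_u + x_j)/2`), then `3·x_{2i-1} ≥ x_u + 2^{2i} - 3` whenever
`2i - 1 ≤ d` and `3·x_{2i} ≥ 2·x_u + 2^{2i+1} - 3` whenever `2i ≤ d`; in particular
`x_d + 1 ≥ (x_u + 2^{d+1})/3 ≥ 2^{d+1}/3`. -/
theorem stmt5 (d : ℕ) (hd : 1 ≤ d) (xu : ℤ) (hxu : 0 ≤ xu) (x : ℕ → ℤ)
    (h1 : (xu : ℝ) / 3 < (x 1 : ℝ))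
    (h2 : ∀ j : ℕ, 2 ≤ j → j ≤ d → j % 2 = 0 → (x (j - 1) : ℝ) < (x j : ℝ) / 2)
    (h3 : ∀ j : ℕ, 3 ≤ j → j ≤ d → j % 2 = 1 →
      (x (j - 1) : ℝ) < ((xu : ℝ) + (x j : ℝ)) / 2) :
    (∀ i : ℕ, 1 ≤ i → 2 * i - 1 ≤ d → xu + 2 ^ (2 * i) - 3 ≤ 3 * x (2 * i - 1)) ∧
    (∀ i : ℕ, 1 ≤ i → 2 * i ≤ d → 2 * xu + 2 ^ (2 * i + 1) - 3 ≤ 3 * x (2 * i)) ∧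
    (((xu : ℝ) + 2 ^ (d + 1)) / 3 ≤ (x d : ℝ) + 1 ∧
      (2 : ℝ) ^ (d + 1) / 3 ≤ ((xu : ℝ) + 2 ^ (d + 1)) / 3) := by
  have base : xu + 1 ≤ 3 * x 1 := by
    have h : (xu : ℝ) < 3 * x 1 := by linarith
    exact_mod_cast h
  have even_step : ∀ j : ℕ, 1 ≤ j → j + 1 ≤ d → j % 2 = 1 → 2 * x j + 1 ≤ x (j + 1) := by
    intro j hj hjd hodd
    have h := h2 (j + 1) (by omega) hjd (by omega)
    rw [Nat.add_sub_cancel] at h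
    have h' : 2 * (x j : ℝ) < x (j + 1) := by linarith
    exact_mod_cast h'
  have odd_step : ∀ j : ℕ, 2 ≤ j → j + 1 ≤ d → j % 2 = 0 →
      2 * x j + 1 ≤ xu + x (j + 1) := by
    intro j hj hjd heven
    have h := h3 (j + 1) (by omega) hjd (by omega)
    rw [Nat.add_sub_cancel] at h
    have h' : 2 * (x j : ℝ) < xu + x (j + 1) := by linarith
    exact_mod_cast h'
  have bound : ∀ j : ℕ, 1 ≤ j → j ≤ d →
      (j % 2 = 1 → xu + 2 ^ (j + 1) - 3 ≤ 3 * x j) ∧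
      (j % 2 = 0 → 2 * xu + 2 ^ (j + 1) - 3 ≤ 3 * x j) := by
    intro j hj
    induction j, hj using Nat.le_induction with
    | base =>
      intro _
      refine ⟨fun _ => ?_, fun h => by omega⟩
      norm_num
      linarith
    | succ j hj ih =>
      intro hjd
      obtain ⟨ih_odd, ih_even⟩ := ih (by omega)
      rw [pow_succ (2 : ℤ) (j + 1)]
      refine ⟨fun h => ?_, fun h => ?_⟩
      · have h_prev := ih_even (by omega)
        have h_step := odd_step j (by omega) hjd (by omega)
        linarith
      · have h_prev := ih_odd (by omega)
        have h_step := even_step j hj hjd (by omega)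
        linarith
  refine ⟨fun i hi hid => ?_, fun i hi hid => ?_, ?_, ?_⟩
  · have h := (bound (2 * i - 1) (by omega) hid).1 (by omega)
    rwa [Nat.sub_add_cancel (by omega)] at h
  · exact (bound (2 * i) (by omega) hid).2 (by omega)
  · have h : xu + 2 ^ (d + 1) ≤ 3 * (x d + 1) := by
      obtain ⟨h_odd, h_even⟩ := bound d hd le_rfl
      rcases Nat.mod_two_eq_zero_or_one d with hd2 | hd2
      · linarith [h_even hd2]
      · linarith [h_odd hd2]
    have h' : (xu : ℝ) + 2 ^ (d + 1) ≤ 3 * (x d + 1) := by exact_mod_cast h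
    linarith
  · have h : (0 : ℝ) ≤ xu := by exact_mod_cast hxu
    gcongr
    linarith
end

section
/- Let x_u ≥ 0 be an integer, let d ≥ 1, and let c_1, …, c_d be integers satisfying 3·c_1 ≥ x_u + 1, c_{2i} ≥ 2·c_{2i−1} + 1 whenever 2i ≤ d, and c_{2i+1} ≥ 2·c_{2i} − x_u + 1 whenever 2i+1 ≤ d. Then 3·c_{2i−1} ≥ x_u + 2^{2i} − 3 whenever 2i−1 ≤ d, and 3·c_{2i} ≥ 2·x_u + 2^{2i+1} − 3 whenever 2i ≤ d; in particular 3·(c_d + 1) ≥ x_u + 2^{d+1}. -/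
/-- If `x_u ≥ 0`, `3·c_1 ≥ x_u + 1`, `c_{2i} ≥ 2·c_{2i-1} + 1` whenever
`2i ≤ d` and `c_{2i+1} ≥ 2·c_{2i} - x_u + 1` whenever `2i + 1 ≤ d`, then
`3·c_{2i-1} ≥ x_u + 2^{2i} - 3` whenever `2i - 1 ≤ d` and
`3·c_{2i} ≥ 2·x_u + 2^{2i+1} - 3` whenever `2i ≤ d`; in particular
`3·(c_d + 1) ≥ x_u + 2^{d+1}`. -/
theorem stmt6 (xu : ℤ) (hxu : 0 ≤ xu) (d : ℕ) (hd : 1 ≤ d) (c : ℕ → ℤ)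
    (h1 : xu + 1 ≤ 3 * c 1)
    (h2 : ∀ i : ℕ, 1 ≤ i → 2 * i ≤ d → 2 * c (2 * i - 1) + 1 ≤ c (2 * i))
    (h3 : ∀ i : ℕ, 1 ≤ i → 2 * i + 1 ≤ d → 2 * c (2 * i) - xu + 1 ≤ c (2 * i + 1)) :
    (∀ i : ℕ, 1 ≤ i → 2 * i - 1 ≤ d → xu + 2 ^ (2 * i) - 3 ≤ 3 * c (2 * i - 1)) ∧
    (∀ i : ℕ, 1 ≤ i → 2 * i ≤ d → 2 * xu + 2 ^ (2 * i + 1) - 3 ≤ 3 * c (2 * i)) ∧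
    xu + 2 ^ (d + 1) ≤ 3 * (c d + 1) := by
  have odd : ∀ k : ℕ, 2 * k + 1 ≤ d → xu + 2 ^ (2 * k + 2) - 3 ≤ 3 * c (2 * k + 1) := by
    intro k
    induction k with
    | zero => intro _; norm_num; linarith
    | succ k ih =>
      intro hk
      have hc := ih (by omega)
      have he := h2 (k + 1) (by omega) (by omega)
      have ho := h3 (k + 1) (by omega) hk
      rw [show 2 * (k + 1) - 1 = 2 * k + 1 by omega] at he
      have hp : (2 : ℤ) ^ (2 * (k + 1) + 2) = 4 * 2 ^ (2 * k + 2) := by ring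
      linarith
  have odd' : ∀ i : ℕ, 1 ≤ i → 2 * i - 1 ≤ d → xu + 2 ^ (2 * i) - 3 ≤ 3 * c (2 * i - 1) := by
    intro i hi hid
    obtain ⟨k, rfl⟩ := Nat.exists_eq_add_of_le' hi
    exact odd k (by omega)
  have even : ∀ i : ℕ, 1 ≤ i → 2 * i ≤ d → 2 * xu + 2 ^ (2 * i + 1) - 3 ≤ 3 * c (2 * i) := by
    intro i hi hid
    have hc := odd' i hi (by omega)
    have he := h2 i hi hid
    rw [pow_succ]
    linarith
  refine ⟨odd', even, ?_⟩
  obtain ⟨k, hk | hk⟩ := Nat.even_or_odd' d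
  · have hc := even k (by omega) hk.ge
    rw [hk]
    linarith
  · have hc := odd k hk.ge
    rw [hk]
    linarith
end
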